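/- Let n ≥ 1 and d be integers with |d| ≥ 2, with d-sequence n = n_0 > n_1 > ⋯ > n_k = n_{k+1}, d_i = gcd(n_i, |d|), and m = n_k. Let 𝒱 be a set containing exactly one element of each orbit of v ↦ d·v on ℤ/m other than {0}, chosen so that the class of m/p^j belongs to 𝒱 for every prime p dividing m and every 1 ≤ j ≤ ν_p(m); for v ∈ 𝒱 let o(v) be its orbit size. For v ∈ 𝒱 define c(v) by: c(v) = π_p(m) if v = m/π_p(m) for a prime p | m with p ≠ 2 or d ≡ 1 (mod 4) or 4 ∤ m; c(v) = π_2(m)/2 if 4 | m, d ≡ 3 (mod 4), and v = m/π_2(m); c(v) = 2 if 4 | m, d ≡ 3 (mod 4), and v = m/2; and c(v) = 1 otherwise. Then S(n,d) ≅ [⊕_{i=0}^{k−1} ( ℤ/(|d|^{i+1}/d_i) ⊕ (ℤ/|d|^{i+1})^{n_i − 2n_{i+1} + n_{i+2} − 1} )] ⊕ [⊕_{v ∈ 𝒱} ℤ/(|d^{o(v)} − 1|/c(v))]. In particular, for d ≥ 2 this is the sandpile (critical) group of the generalized de Bruijn graph DB(n,d), and for d ≤ −2 that of the generalized Kautz graph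 Ktz(n,|d|). -/

import Mathlib

open Finset

noncomputable section

/-- The ring `ℤ[x]/(x^n - 1)`, realized as the group algebra `ℤ[ℤ/n]`;
the class of `x^j` (for `j : ℤ`) corresponds to `xp n (j : ZMod n)`. -/
abbrev Rn (n : ℕ) : Type := AddMonoidAlgebra ℤ (ZMod n)

/-- The class of `x^w` in `ℤ[x]/(x^n - 1)`. -/
def xp (n : ℕ) (w : ZMod n) : Rn n := AddMonoidAlgebra.single w 1

/-- `e_v = x^v - 1`. -/
def eV (n : ℕ) (w : ZMod n) : Rn n := xp n w - 1

/-- `ε_v = d·e_v - e_{d·v}`. -/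
def epsV (n : ℕ) (d : ℤ) (w : ZMod n) : Rn n := d • eV n w - eV n ((d : ZMod n) * w)

/-- `𝒵_n`, the ℤ-span of the `e_v`, `1 ≤ v ≤ n-1`. -/
def ZSpan (n : ℕ) : Submodule ℤ (Rn n) :=
  Submodule.span ℤ {a : Rn n | ∃ v : ℤ, 1 ≤ v ∧ v ≤ (n : ℤ) - 1 ∧ a = eV n (v : ZMod n)}

/-- `ℰ_{n,d}`, the ℤ-span of the `ε_v`, `1 ≤ v ≤ n-1`. -/
def ESpan (n : ℕ) (d : ℤ) : Submodule ℤ (Rn n) :=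
  Submodule.span ℤ {a : Rn n | ∃ v : ℤ, 1 ≤ v ∧ v ≤ (n : ℤ) - 1 ∧ a = epsV n d (v : ZMod n)}

/-- `1 + x + ⋯ + x^{|d|-1}`. -/
def geomT (n : ℕ) (d : ℤ) : Rn n := ∑ i ∈ Finset.range d.natAbs, xp n (i : ZMod n)

/-- `f_v`: the Laplacian row polynomial of `DB(n,d)` (for `d ≥ 0`) resp. of
`Ktz(n,|d|)` (for `d < 0`). -/
def fV (n : ℕ) (d : ℤ) (v : ℤ) : Rn n :=
  if 0 ≤ d then d • xp n ((v : ZMod n)) - xp n (((d * v : ℤ) : ZMod n)) * geomT n d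
  else d • xp n ((v : ZMod n)) + xp n (((d * (v + 1) : ℤ) : ZMod n)) * geomT n d

/-- `F_{n,d}`, the ℤ-span of the `f_v`, `1 ≤ v ≤ n-1`. -/
def FSpan (n : ℕ) (d : ℤ) : Submodule ℤ (Rn n) :=
  Submodule.span ℤ {a : Rn n | ∃ v : ℤ, 1 ≤ v ∧ v ≤ (n : ℤ) - 1 ∧ a = fV n d v}

/-- The sand dune group `Σ(n,d) = 𝒵_n / ℰ_{n,d}`. -/
abbrev SandDune (n : ℕ) (d : ℤ) :=
  ZSpan n ⧸ Submodule.comap (ZSpan n).subtype (ESpan n d)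

/-- The sandpile (critical) group `S(n,d) = 𝒵_n / F_{n,d}`. -/
abbrev Sandpile (n : ℕ) (d : ℤ) :=
  ZSpan n ⧸ Submodule.comap (ZSpan n).subtype (FSpan n d)

/-- The `d`-sequence of `n`: `n_0 = n`, `n_{i+1} = n_i / gcd(n_i, |d|)`. -/
def dSeq (n : ℕ) (d : ℤ) : ℕ → ℕ
  | 0 => n
  | i + 1 => dSeq n d i / Nat.gcd (dSeq n d i) d.natAbs

/-- The number of elements of an additive group killed by `t`. -/
def torsCard (G : Type*) [AddCommGroup G] (t : ℕ) : ℕ := Nat.card {x : G // t • x = 0}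

theorem torsCard_congr {G H : Type*} [AddCommGroup G] [AddCommGroup H] (e : G ≃+ H) (t : ℕ) :
    torsCard G t = torsCard H t :=
  Nat.card_congr (e.toEquiv.subtypeEquiv fun x => by
    change t • x = 0 ↔ t • e x = 0
    rw [← map_nsmul, map_eq_zero_iff e e.injective])

theorem torsCard_pi {ι : Type*} [Fintype ι] {G : ι → Type*} [∀ i, AddCommGroup (G i)] (t : ℕ) :
    torsCard (∀ i, G i) t = ∏ i, torsCard (G i) t := by
  unfold torsCard
  rw [← Nat.card_pi]
  refine Nat.card_congr ⟨fun x i => ⟨x.1 i, congrFun x.2 i⟩,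
    fun y => ⟨fun i => (y i).1, funext fun i => (y i).2⟩, fun _ => rfl, fun _ => rfl⟩

theorem torsCard_prod {G H : Type*} [AddCommGroup G] [AddCommGroup H] (t : ℕ) :
    torsCard (G × H) t = torsCard G t * torsCard H t := by
  unfold torsCard
  rw [← Nat.card_prod]
  refine Nat.card_congr ⟨fun x => (⟨x.1.1, congrArg Prod.fst x.2⟩, ⟨x.1.2, congrArg Prod.snd x.2⟩),
    fun y => ⟨(y.1.1, y.2.1), Prod.ext y.1.2 y.2.2⟩, fun _ => rfl, fun _ => rfl⟩

theorem torsCard_zmod {N : ℕ} (hN : N ≠ 0) (t : ℕ) : torsCard (ZMod N) t = Nat.gcd t N := by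
  have : NeZero N := ⟨hN⟩
  have := IsAddCyclic.card_nsmulAddMonoidHom_ker (ZMod N) t
  rw [Nat.card_zmod, Nat.gcd_comm] at this
  exact this

theorem pow_min_sum {ι : Type*} [Fintype ι] {q e : ι → ℕ} (hq : ∀ i, (q i).Prime) {p : ℕ}
    (hp : p.Prime) (b : ℕ) :
    torsCard (∀ i, ZMod (q i ^ e i)) (p ^ b) = p ^ ∑ i, if q i = p then min b (e i) else 0 := by
  classical
  rw [torsCard_pi, ← Finset.prod_pow_eq_pow_sum]
  refine Finset.prod_congr rfl fun i _ => ?_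
  rw [torsCard_zmod (pow_ne_zero _ (hq i).ne_zero)]
  split_ifs with h
  · rw [h]
    rcases le_total b (e i) with hb | hb
    · rw [min_eq_left hb, Nat.gcd_eq_left (pow_dvd_pow _ hb)]
    · rw [min_eq_right hb, Nat.gcd_eq_right (pow_dvd_pow _ hb)]
  · rw [pow_zero]
    exact Nat.Coprime.pow _ _ ((Nat.coprime_primes hp (hq i)).2 (Ne.symm h))

theorem card_exponent_eq {ι : Type*} [Fintype ι] [DecidableEq ι] (q e : ι → ℕ) (p b : ℕ) :
    ((#{i | q i = p ∧ e i = b + 1} : ℕ) : ℤ) =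
      2 * (∑ i, if q i = p then min (b + 1) (e i) else 0 : ℕ)
      - (∑ i, if q i = p then min b (e i) else 0 : ℕ)
      - (∑ i, if q i = p then min (b + 2) (e i) else 0 : ℕ) := by
  rw [Finset.card_filter]
  push_cast
  rw [Finset.mul_sum, ← Finset.sum_sub_distrib, ← Finset.sum_sub_distrib]
  refine Finset.sum_congr rfl fun i _ => ?_
  by_cases h : q i = p
  · simp only [h, true_and, if_true]
    split_ifs with h2 <;> omega
  · simp [h]

theorem exists_equiv_of_card_fiber {ι κ γ : Type*} [Fintype ι] [Fintype κ] [DecidableEq γ]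
    (f : ι → γ) (g : κ → γ) (h : ∀ c, #{i | f i = c} = #{j | g j = c}) :
    ∃ E : ι ≃ κ, ∀ i, g (E i) = f i := by
  have key : ∀ c, Nonempty ({i // f i = c} ≃ {j // g j = c}) := fun c =>
    ⟨Fintype.equivOfCardEq (by rw [Fintype.card_subtype, Fintype.card_subtype, h c])⟩
  let F := fun c => (key c).some
  refine ⟨(Equiv.sigmaFiberEquiv f).symm.trans ((Equiv.sigmaCongrRight F).trans
    (Equiv.sigmaFiberEquiv g)), fun i => ?_⟩
  exact (F (f i) ⟨i, rfl⟩).2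

theorem exists_equiv_pi_zmod (G : Type*) [AddCommGroup G] [Finite G] :
    ∃ (ι : Type) (_ : Fintype ι) (q e : ι → ℕ), (∀ i, (q i).Prime) ∧ (∀ i, e i ≠ 0) ∧
      Nonempty (G ≃+ ∀ i, ZMod (q i ^ e i)) := by
  classical
  obtain ⟨ι, hι, q, hq, e, ⟨E⟩⟩ := AddCommGroup.equiv_directSum_zmod_of_finite G
  refine ⟨{i // e i ≠ 0}, inferInstance, fun i => q i, fun i => e i, fun i => hq i, fun i => i.2,
    ⟨(E.trans (DirectSum.addEquivProd _)).trans (AddEquiv.ofBijective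
      (AddMonoidHom.pi (fun i : {i // e i ≠ 0} =>
        Pi.evalAddMonoidHom (fun i => ZMod (q i ^ e i)) i.1))
      ⟨?_, ?_⟩)⟩⟩
  · intro x y hxy
    funext i
    by_cases hi : e i = 0
    · have : Subsingleton (ZMod (q i ^ e i)) := by rw [hi, pow_zero]; infer_instance
      exact Subsingleton.elim _ _
    · exact congrFun hxy ⟨i, hi⟩
  · intro y
    refine ⟨fun i => if hi : e i ≠ 0 then y ⟨i, hi⟩ else 0, ?_⟩
    funext i
    exact dif_pos i.2

/-- Finite abelian groups are classified by the sizes of their prime power torsion subgroups. -/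
theorem nonempty_addEquiv_of_torsCard {G H : Type*} [AddCommGroup G] [AddCommGroup H] [Finite G]
    [Finite H] (h : ∀ p : ℕ, p.Prime → ∀ b : ℕ, torsCard G (p ^ b) = torsCard H (p ^ b)) :
    Nonempty (G ≃+ H) := by
  classical
  obtain ⟨ι, _, q, e, hq, he, ⟨E⟩⟩ := exists_equiv_pi_zmod G
  obtain ⟨κ, _, q', e', hq', he', ⟨E'⟩⟩ := exists_equiv_pi_zmod H
  have key : ∀ p : ℕ, p.Prime → ∀ b : ℕ, (∑ i, if q i = p then min b (e i) else 0) =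
      ∑ i, if q' i = p then min b (e' i) else 0 := by
    intro p hp b
    have h1 := h p hp b
    rw [torsCard_congr E, torsCard_congr E', pow_min_sum hq hp, pow_min_sum hq' hp] at h1
    exact Nat.pow_right_injective hp.two_le h1
  obtain ⟨F, hF⟩ := exists_equiv_of_card_fiber (fun i => (q i, e i)) (fun j => (q' j, e' j)) (by
    rintro ⟨p, b⟩
    simp only [Prod.mk.injEq]
    by_cases hp : p.Prime
    · obtain _ | b := b
      · simp [he, he']
      · have := card_exponent_eq q e p b
        rw [key p hp, key p hp, key p hp, ← card_exponent_eq q' e' p b] at this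
        exact_mod_cast this
    · have h1 : ∀ i, q i ≠ p := fun i hi => hp (hi ▸ hq i)
      have h2 : ∀ i, q' i ≠ p := fun i hi => hp (hi ▸ hq' i)
      simp [h1, h2])
  have hF' : ∀ i, q i ^ e i = q' (F i) ^ e' (F i) := fun i => by
    have := hF i
    simp only [Prod.mk.injEq] at this
    rw [this.1, this.2]
  let E3 : (∀ i, ZMod (q i ^ e i)) ≃+ ∀ i, ZMod (q' (F i) ^ e' (F i)) :=
    AddEquiv.piCongrRight fun i => (ZMod.ringEquivCongr (hF' i)).toAddEquiv
  let E4 : (∀ i, ZMod (q' (F i) ^ e' (F i))) ≃+ ∀ j, ZMod (q' j ^ e' j) :=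
    { Equiv.piCongrLeft (fun j => ZMod (q' j ^ e' j)) F with
      map_add' := fun x y => by
        funext j
        obtain ⟨i, rfl⟩ := F.surjective j
        simp [Equiv.piCongrLeft_apply_apply] }
  exact ⟨((E.trans E3).trans E4).trans E'.symm⟩

/-- The map induced by `v ↦ d·v` on the free group on `ℤ/n`. -/
def pushMul (n : ℕ) (d : ℤ) : (ZMod n →₀ ℤ) →ₗ[ℤ] (ZMod n →₀ ℤ) :=
  Finsupp.lmapDomain ℤ ℤ fun v => (d : ZMod n) * v

/-- The map `d - [d]` on the free group on `ℤ/n`. -/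
def duneMap (n : ℕ) (d : ℤ) : (ZMod n →₀ ℤ) →ₗ[ℤ] (ZMod n →₀ ℤ) :=
  d • LinearMap.id - pushMul n d

/-- The linear extension of the identity of `ℤ/n`. -/
def weight (n : ℕ) : (ZMod n →₀ ℤ) →ₗ[ℤ] ZMod n := Finsupp.linearCombination ℤ id

/-- The relations of the sand dune group, in terms of the free group on `ℤ/n`. -/
def duneRel (n : ℕ) (d : ℤ) : Submodule ℤ (ZMod n →₀ ℤ) :=
  LinearMap.range (duneMap n d) ⊔ Submodule.span ℤ {Finsupp.single 0 1}

/-- The group generated by `ℤ/n` with relations `d·[v] = [d·v]` and `[0] = 0`. -/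
abbrev Dune (n : ℕ) (d : ℤ) := (ZMod n →₀ ℤ) ⧸ duneRel n d

theorem pushMul_single (n : ℕ) (d : ℤ) (v : ZMod n) (a : ℤ) :
    pushMul n d (Finsupp.single v a) = Finsupp.single ((d : ZMod n) * v) a := by
  simp [pushMul]

theorem duneMap_apply (n : ℕ) (d : ℤ) (y : ZMod n →₀ ℤ) :
    duneMap n d y = d • y - pushMul n d y := rfl

theorem duneMap_single (n : ℕ) (d : ℤ) (v : ZMod n) :
    duneMap n d (Finsupp.single v 1) =
      d • Finsupp.single v 1 - Finsupp.single ((d : ZMod n) * v) 1 := by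
  rw [duneMap_apply, pushMul_single]

theorem weight_single (n : ℕ) (v : ZMod n) (a : ℤ) :
    weight n (Finsupp.single v a) = a • v := by
  simp [weight]

theorem weight_pushMul (n : ℕ) (d : ℤ) (y : ZMod n →₀ ℤ) :
    weight n (pushMul n d y) = d • weight n y := by
  have : weight n ∘ₗ pushMul n d = d • weight n := by
    ext v
    simp [pushMul_single, weight_single]
  exact LinearMap.congr_fun this y

theorem weight_duneMap (n : ℕ) (d : ℤ) (y : ZMod n →₀ ℤ) : weight n (duneMap n d y) = 0 := by
  rw [duneMap_apply, map_sub, weight_pushMul, map_smul, sub_self]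

theorem duneRel_le_ker_weight (n : ℕ) (d : ℤ) : duneRel n d ≤ LinearMap.ker (weight n) := by
  refine sup_le ?_ ?_
  · rintro _ ⟨y, rfl⟩
    exact weight_duneMap n d y
  · rw [Submodule.span_le]
    rintro _ rfl
    simp [weight_single]

/-- The map from the sand dune group to `ℤ/n` with `[v] ↦ v`. -/
def duneWeight (n : ℕ) (d : ℤ) : Dune n d →ₗ[ℤ] ZMod n :=
  (duneRel n d).liftQ (weight n) (duneRel_le_ker_weight n d)

/-- The augmentation of `R_n`. -/
def aug (n : ℕ) : Rn n →ₗ[ℤ] ℤ :=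
  Finsupp.linearCombination ℤ (fun _ => (1 : ℤ)) ∘ₗ
    (AddMonoidAlgebra.coeffLinearEquiv ℤ).toLinearMap

theorem coeff_xp (n : ℕ) (v : ZMod n) :
    AddMonoidAlgebra.coeffLinearEquiv ℤ (xp n v) = Finsupp.single v 1 :=
  AddMonoidAlgebra.coeff_single v 1

theorem xp_mul (n : ℕ) (v w : ZMod n) : xp n v * xp n w = xp n (v + w) := by
  simp [xp, AddMonoidAlgebra.single_mul_single]

theorem xp_zero (n : ℕ) : xp n 0 = 1 := (AddMonoidAlgebra.one_def).symm

theorem aug_xp (n : ℕ) (v : ZMod n) : aug n (xp n v) = 1 := by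
  change Finsupp.linearCombination ℤ (fun _ => (1 : ℤ))
    (AddMonoidAlgebra.coeffLinearEquiv ℤ (xp n v)) = 1
  rw [coeff_xp]
  simp

theorem Rn_induction {n : ℕ} {P : Rn n → Prop} (h1 : ∀ v, P (xp n v))
    (h2 : ∀ x y, P x → P y → P (x + y)) (h3 : ∀ (a : ℤ) x, P x → P (a • x)) (y : Rn n) : P y :=
  AddMonoidAlgebra.induction_on y (fun v => h1 v) h2 h3

theorem Rn_linearMap_ext {n : ℕ} {M : Type*} [AddCommGroup M] {f g : Rn n →ₗ[ℤ] M}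
    (h : ∀ v, f (xp n v) = g (xp n v)) (y : Rn n) : f y = g y :=
  Rn_induction (P := fun y => f y = g y) h (fun x y hx hy => by rw [map_add, map_add, hx, hy])
    (fun a x hx => by rw [map_smul, map_smul, hx]) y

theorem aug_mul (n : ℕ) (x y : Rn n) : aug n (x * y) = aug n x * aug n y := by
  have key : ∀ v y, aug n (xp n v * y) = aug n y := fun v y =>
    Rn_linearMap_ext (f := aug n ∘ₗ LinearMap.mulLeft ℤ (xp n v)) (g := aug n) (fun w => by
      simp [xp_mul, aug_xp]) y
  refine Rn_linearMap_ext (f := aug n ∘ₗ LinearMap.mulRight ℤ y) (g := (aug n).smulRight (aug n y))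
    (fun w => ?_) x
  simp [key, aug_xp]

section Dune

variable {n : ℕ} [NeZero n]

theorem eV_mem_ZSpan (v : ZMod n) : eV n v ∈ ZSpan n := by
  by_cases hv : v = 0
  · rw [hv, eV, xp_zero, sub_self]
    exact zero_mem _
  · refine Submodule.subset_span ⟨v.val, ?_, ?_, ?_⟩
    · have := (ZMod.val_ne_zero v).2 hv
      omega
    · have := v.val_lt
      omega
    · simp

theorem mem_ZSpan_iff (y : Rn n) : y ∈ ZSpan n ↔ aug n y = 0 := by
  constructor
  · intro h
    refine Submodule.span_induction (p := fun y _ => aug n y = 0) ?_ (map_zero _)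
      (fun x y _ _ hx hy => by rw [map_add, hx, hy, add_zero])
      (fun a x _ hx => by rw [map_smul, hx, smul_zero]) h
    rintro _ ⟨v, -, -, rfl⟩
    rw [eV, map_sub, aug_xp, ← xp_zero, aug_xp, sub_self]
  · intro h
    have key : ∀ y : Rn n, y - aug n y • 1 ∈ ZSpan n := by
      refine Rn_induction (fun v => ?_) (fun x y hx hy => ?_) (fun a x hx => ?_)
      · rw [aug_xp, one_smul]
        exact eV_mem_ZSpan v
      · convert add_mem hx hy using 1
        rw [map_add]
        module
      · convert Submodule.smul_mem _ a hx using 1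
        rw [map_smul, smul_eq_mul]
        module
    simpa [h] using key y

theorem eq_zero_of_sub_one_mul_eq_zero {z : Rn n} (hz : aug n z = 0) (h : (xp n 1 - 1) * z = 0) :
    z = 0 := by
  have h1 : ∀ v, z.coeff (v + 1) = z.coeff v := by
    intro v
    have h2 : xp n 1 * z = z := by
      rw [sub_mul, one_mul, sub_eq_zero] at h
      exact h
    have h3 := congrArg (fun y : Rn n => y.coeff (v + 1)) h2
    simp only [xp, AddMonoidAlgebra.coeff_single_mul_apply] at h3
    rw [← h3]
    simp
  have h2 : ∀ k : ℕ, z.coeff (k : ZMod n) = z.coeff 0 := by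
    intro k
    induction k with
    | zero => simp
    | succ k ih => rw [Nat.cast_succ, h1, ih]
  have h3 : ∀ v, z.coeff v = z.coeff 0 := fun v => by
    rw [← h2 v.val, ZMod.natCast_zmod_val]
  have h4 : aug n z = n * z.coeff 0 := by
    change Finsupp.linearCombination ℤ (fun _ => (1 : ℤ)) z.coeff = _
    rw [Finsupp.linearCombination_apply, Finsupp.sum_fintype _ _ (by simp)]
    simp [h3, ZMod.card]
  have h5 : z.coeff 0 = 0 := by
    rw [hz] at h4
    have := NeZero.ne n
    simpa [this] using h4.symm
  ext v
  rw [h3, h5]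
  simp

omit [NeZero n] in
theorem sub_one_mul_geomT (d : ℤ) :
    (xp n 1 - 1) * geomT n d = xp n (d.natAbs : ZMod n) - 1 := by
  rw [geomT, Finset.mul_sum]
  have : ∀ i : ℕ, (xp n 1 - 1) * xp n (i : ZMod n) =
      xp n ((i + 1 : ℕ) : ZMod n) - xp n (i : ZMod n) := fun i => by
    rw [sub_mul, one_mul, xp_mul, Nat.cast_succ, add_comm]
  rw [Finset.sum_congr rfl fun i _ => this i,
    Finset.sum_range_sub (fun i : ℕ => xp n (i : ZMod n))]
  simp [xp_zero]

omit [NeZero n] in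
theorem sub_one_mul_fV (d v : ℤ) :
    (xp n 1 - 1) * fV n d v =
      epsV n d ((v : ZMod n) + 1) - epsV n d (v : ZMod n) := by
  have hx : (xp n 1 - 1) * xp n (v : ZMod n) = xp n ((v : ZMod n) + 1) - xp n (v : ZMod n) := by
    rw [sub_mul, one_mul, xp_mul, add_comm]
  rw [fV]
  split_ifs with hd
  · have hd' : ((d.natAbs : ℕ) : ZMod n) = (d : ZMod n) := by
      rw [← Int.cast_natCast, Int.natAbs_of_nonneg hd]
    rw [mul_sub, mul_left_comm, sub_one_mul_geomT, mul_smul_comm, hx, mul_sub, xp_mul, hd',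
      mul_one, epsV, epsV, eV, eV, eV, eV]
    push_cast
    rw [mul_add, mul_one]
    module
  · have hd' : ((d.natAbs : ℕ) : ZMod n) = -(d : ZMod n) := by
      rw [← Int.cast_natCast, Int.ofNat_natAbs_of_nonpos (by omega), Int.cast_neg]
    rw [mul_add, mul_left_comm, sub_one_mul_geomT, mul_smul_comm, hx, mul_sub, xp_mul, hd',
      mul_one, epsV, epsV, eV, eV, eV, eV]
    push_cast
    rw [mul_add, mul_one, add_neg_cancel_right]
    module

omit [NeZero n] in
theorem aug_fV (d v : ℤ) : aug n (fV n d v) = 0 := by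
  have hg : aug n (geomT n d) = d.natAbs := by
    simp [geomT, aug_xp]
  rw [fV]
  split_ifs with hd
  · rw [map_sub, map_smul, aug_mul, aug_xp, aug_xp, hg]
    simp [abs_of_nonneg hd]
  · rw [map_add, map_smul, aug_mul, aug_xp, aug_xp, hg]
    simp [abs_of_neg (not_le.1 hd)]

theorem FSpan_le_ZSpan (d : ℤ) : FSpan n d ≤ ZSpan n := by
  rw [FSpan, Submodule.span_le]
  rintro _ ⟨v, -, -, rfl⟩
  exact (mem_ZSpan_iff _).2 (aug_fV d v)

theorem exists_mem_FSpan_epsV (d : ℤ) (v : ZMod n) :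
    ∃ g ∈ FSpan n d, (xp n 1 - 1) * g = epsV n d v := by
  have h0 : epsV n d 0 = 0 := by simp [epsV, eV, xp_zero]
  have key : ∀ i : ℕ, i < n → ∃ g ∈ FSpan n d,
      (xp n 1 - 1) * g = epsV n d ((n - i : ℤ) : ZMod n) := by
    intro i
    induction i with
    | zero =>
      intro _
      exact ⟨0, zero_mem _, by simp [h0]⟩
    | succ i ih =>
      intro hi
      obtain ⟨g, hg, hg'⟩ := ih (by omega)
      refine ⟨g - fV n d (n - (i + 1 : ℕ)), sub_mem hg (Submodule.subset_span
        ⟨_, by omega, by omega, rfl⟩), ?_⟩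
      rw [mul_sub, hg', sub_one_mul_fV]
      have : (((n : ℤ) - (i + 1 : ℕ) : ℤ) : ZMod n) + 1 = ((n - i : ℤ) : ZMod n) := by
        push_cast
        ring
      rw [this]
      abel
  by_cases hv : v = 0
  · exact ⟨0, zero_mem _, by simp [hv, h0]⟩
  · have h1 := (ZMod.val_ne_zero v).2 hv
    have h2 := v.val_lt
    obtain ⟨g, hg, hg'⟩ := key (n - v.val) (by omega)
    refine ⟨g, hg, ?_⟩
    rw [hg']
    congr 1
    rw [Nat.cast_sub h2.le]
    simp

/-- Multiplication by `x - 1` as a map to the sand dune group. -/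
def toDune (n : ℕ) (d : ℤ) : ZSpan n →ₗ[ℤ] Dune n d :=
  (duneRel n d).mkQ ∘ₗ (AddMonoidAlgebra.coeffLinearEquiv ℤ).toLinearMap ∘ₗ
    LinearMap.mulLeft ℤ (xp n 1 - 1) ∘ₗ (ZSpan n).subtype

omit [NeZero n] in
theorem coeff_epsV_mem (d : ℤ) (v : ZMod n) :
    AddMonoidAlgebra.coeffLinearEquiv ℤ (epsV n d v) ∈ duneRel n d := by
  have : AddMonoidAlgebra.coeffLinearEquiv ℤ (epsV n d v) =
      duneMap n d (Finsupp.single v 1) + (1 - d) • Finsupp.single 0 1 := by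
    rw [epsV, eV, eV, ← xp_zero, map_sub, map_smul, map_sub, map_sub, coeff_xp, coeff_xp, coeff_xp,
      duneMap_single]
    module
  rw [this]
  exact add_mem (Submodule.mem_sup_left ⟨_, rfl⟩)
    (Submodule.smul_mem _ _ (Submodule.mem_sup_right (Submodule.mem_span_singleton_self _)))

theorem exists_mem_FSpan_duneMap (d : ℤ) (y : ZMod n →₀ ℤ) : ∃ g ∈ FSpan n d, ∃ a : ℤ,
    AddMonoidAlgebra.coeffLinearEquiv ℤ ((xp n 1 - 1) * g) =
      duneMap n d y + a • Finsupp.single 0 1 := by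
  induction y using Finsupp.induction_linear with
  | zero => exact ⟨0, zero_mem _, 0, by simp⟩
  | add x y hx hy =>
    obtain ⟨g, hg, a, h⟩ := hx
    obtain ⟨g', hg', a', h'⟩ := hy
    refine ⟨g + g', add_mem hg hg', a + a', ?_⟩
    rw [mul_add, map_add, h, h', map_add]
    module
  | single v b =>
    obtain ⟨g, hg, h⟩ := exists_mem_FSpan_epsV d v
    refine ⟨b • g, Submodule.smul_mem _ _ hg, b * (1 - d), ?_⟩
    have hb : (Finsupp.single v b : ZMod n →₀ ℤ) = b • Finsupp.single v 1 := by simp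
    rw [mul_smul_comm, map_smul, h, hb, map_smul, duneMap_single, epsV, eV, eV, ← xp_zero, map_sub,
      map_smul, map_sub, map_sub, coeff_xp, coeff_xp, coeff_xp]
    module

theorem ker_toDune (d : ℤ) :
    LinearMap.ker (toDune n d) = Submodule.comap (ZSpan n).subtype (FSpan n d) := by
  ext z
  have hk : z ∈ LinearMap.ker (toDune n d) ↔
      AddMonoidAlgebra.coeffLinearEquiv ℤ ((xp n 1 - 1) * (z : Rn n)) ∈ duneRel n d :=
    Submodule.Quotient.mk_eq_zero _
  rw [hk, Submodule.mem_comap, Submodule.subtype_apply]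
  constructor
  · intro h
    obtain ⟨_, ⟨y, rfl⟩, _, hb, h⟩ := Submodule.mem_sup.1 h
    obtain ⟨b, rfl⟩ := Submodule.mem_span_singleton.1 hb
    obtain ⟨g, hg, a, hg'⟩ := exists_mem_FSpan_duneMap d y
    have h1 : (xp n 1 - 1) * ((z : Rn n) - g) = (b - a) • 1 := by
      apply (AddMonoidAlgebra.coeffLinearEquiv (S := ℤ) (M := ZMod n) ℤ).injective
      rw [mul_sub, map_sub, hg', ← h, map_smul, ← xp_zero, coeff_xp]
      module
    have h2 : b - a = 0 := by
      have := congrArg (aug n) h1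
      rw [aug_mul, map_sub, map_smul, ← xp_zero, aug_xp, aug_xp, sub_self, zero_mul] at this
      simpa using this.symm
    rw [h2, zero_smul] at h1
    have h3 := eq_zero_of_sub_one_mul_eq_zero
      ((mem_ZSpan_iff _).1 (sub_mem z.2 (FSpan_le_ZSpan d hg))) h1
    rw [sub_eq_zero] at h3
    rwa [h3]
  · intro h
    refine Submodule.span_induction (p := fun y _ =>
      AddMonoidAlgebra.coeffLinearEquiv ℤ ((xp n 1 - 1) * y) ∈ duneRel n d) ?_ ?_ ?_ ?_ h
    · rintro _ ⟨v, -, -, rfl⟩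
      rw [sub_one_mul_fV, map_sub]
      exact sub_mem (coeff_epsV_mem _ _) (coeff_epsV_mem _ _)
    · simp
    · intro x y _ _ hx hy
      rw [mul_add, map_add]
      exact add_mem hx hy
    · intro a x _ hx
      rw [mul_smul_comm, map_smul]
      exact Submodule.smul_mem _ _ hx

theorem exists_mem_ZSpan_weight (y : ZMod n →₀ ℤ) : ∃ z ∈ ZSpan n, ∃ a k : ℤ,
    (k : ZMod n) = weight n y ∧ y = AddMonoidAlgebra.coeffLinearEquiv ℤ ((xp n 1 - 1) * z) +
      a • Finsupp.single 0 1 + k • (Finsupp.single 1 1 - Finsupp.single 0 1) := by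
  induction y using Finsupp.induction_linear with
  | zero => exact ⟨0, zero_mem _, 0, 0, by simp, by simp⟩
  | add x y hx hy =>
    obtain ⟨z, hz, a, k, h, h'⟩ := hx
    obtain ⟨z₂, hz₂, a₂, k₂, h₂, h₂'⟩ := hy
    refine ⟨z + z₂, add_mem hz hz₂, a + a₂, k + k₂, by simp [h, h₂], ?_⟩
    rw [mul_add, map_add]
    nth_rewrite 1 [h', h₂']
    module
  | single v b =>
    have key : ∀ k : ℕ, ∃ z ∈ ZSpan n, (Finsupp.single (k : ZMod n) 1 : ZMod n →₀ ℤ) =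
        AddMonoidAlgebra.coeffLinearEquiv ℤ ((xp n 1 - 1) * z) +
        Finsupp.single 0 1 + (k : ℤ) • (Finsupp.single 1 1 - Finsupp.single 0 1) := by
      intro k
      induction k with
      | zero => exact ⟨0, zero_mem _, by simp⟩
      | succ k ih =>
        obtain ⟨z, hz, h⟩ := ih
        refine ⟨z + eV n (k : ZMod n), add_mem hz (eV_mem_ZSpan _), ?_⟩
        have h1 : (xp n 1 - 1) * eV n (k : ZMod n) =
            xp n ((k + 1 : ℕ) : ZMod n) - xp n (k : ZMod n) - (xp n 1 - xp n 0) := by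
          rw [eV, mul_sub, sub_mul, xp_mul, xp_zero, Nat.cast_succ, add_comm]
          ring
        rw [mul_add, map_add, h1, map_sub, map_sub, map_sub, coeff_xp, coeff_xp, coeff_xp, coeff_xp]
        rw [h]
        push_cast
        module
    obtain ⟨z, hz, h⟩ := key v.val
    rw [ZMod.natCast_zmod_val] at h
    refine ⟨b • z, Submodule.smul_mem _ _ hz, b, b * v.val, ?_, ?_⟩
    · rw [weight_single]
      simp
    · have hb : (Finsupp.single v b : ZMod n →₀ ℤ) = b • Finsupp.single v 1 := by simp
      rw [hb, h, mul_smul_comm, map_smul]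
      module

theorem exists_toDune_eq (d : ℤ) (x : Dune n d) (hx : duneWeight n d x = 0) :
    ∃ z, toDune n d z = x := by
  obtain ⟨y, rfl⟩ := (duneRel n d).mkQ_surjective x
  have hy : weight n y = 0 := hx
  obtain ⟨z, hz, a, k, hk, h⟩ := exists_mem_ZSpan_weight y
  have hn : ∃ z₁ ∈ ZSpan n, ∃ a₁ : ℤ, AddMonoidAlgebra.coeffLinearEquiv ℤ ((xp n 1 - 1) * z₁) =
      a₁ • Finsupp.single 0 1 + k • (Finsupp.single 1 1 - Finsupp.single 0 1) := by
    rw [hy, ZMod.intCast_zmod_eq_zero_iff_dvd] at hk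
    obtain ⟨c, rfl⟩ := hk
    have : ∀ j : ℕ, ∃ z ∈ ZSpan n, (xp n 1 - 1) * z =
        xp n (j : ZMod n) - 1 - (j : ℤ) • (xp n 1 - 1) := by
      intro j
      induction j with
      | zero => exact ⟨0, zero_mem _, by simp [xp_zero]⟩
      | succ j ih =>
        obtain ⟨z, hz, h⟩ := ih
        refine ⟨z + eV n (j : ZMod n), add_mem hz (eV_mem_ZSpan _), ?_⟩
        have h1 : (xp n 1 - 1) * eV n (j : ZMod n) =
            xp n ((j + 1 : ℕ) : ZMod n) - xp n (j : ZMod n) - (xp n 1 - 1) := by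
          rw [eV, mul_sub, sub_mul, xp_mul, Nat.cast_succ, add_comm]
          ring
        rw [mul_add, h1, h]
        push_cast
        module
    obtain ⟨z₁, hz₁, h₁⟩ := this n
    refine ⟨-c • z₁, Submodule.smul_mem _ _ hz₁, 0, ?_⟩
    rw [mul_smul_comm, h₁, map_smul, ZMod.natCast_self, xp_zero, sub_self, zero_sub, map_neg,
      map_smul, map_sub, coeff_xp, ← xp_zero, coeff_xp]
    module
  obtain ⟨z₁, hz₁, a₁, h₁⟩ := hn
  refine ⟨⟨z + z₁, add_mem hz hz₁⟩, ?_⟩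
  change (duneRel n d).mkQ (AddMonoidAlgebra.coeffLinearEquiv ℤ ((xp n 1 - 1) * (z + z₁))) = _
  rw [← sub_eq_zero, ← map_sub, Submodule.mkQ_apply, Submodule.Quotient.mk_eq_zero, mul_add,
    map_add, h₁]
  have : AddMonoidAlgebra.coeffLinearEquiv ℤ ((xp n 1 - 1) * z) + (a₁ • Finsupp.single 0 1 +
      k • (Finsupp.single 1 1 - Finsupp.single 0 1)) - y = (a₁ - a) • Finsupp.single 0 1 := by
    rw [h]
    module
  rw [this]
  exact Submodule.smul_mem _ _ (Submodule.mem_sup_right (Submodule.mem_span_singleton_self _))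

omit [NeZero n] in
theorem duneWeight_toDune (d : ℤ) (z : ZSpan n) : duneWeight n d (toDune n d z) = 0 := by
  change weight n (AddMonoidAlgebra.coeffLinearEquiv ℤ ((xp n 1 - 1) * (z : Rn n))) = 0
  refine Submodule.span_induction (p := fun y _ =>
    weight n (AddMonoidAlgebra.coeffLinearEquiv ℤ ((xp n 1 - 1) * y)) = 0) ?_ ?_ ?_ ?_ z.2
  · rintro _ ⟨v, -, -, rfl⟩
    have h1 : (xp n 1 - 1) * eV n (v : ZMod n) =
        xp n (1 + v) - xp n (v : ZMod n) - (xp n 1 - xp n 0) := by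
      rw [eV, mul_sub, sub_mul, xp_mul, xp_zero]
      ring
    rw [h1]
    simp only [map_sub, coeff_xp, weight_single]
    simp
  · simp
  · intro x y _ _ hx hy
    rw [mul_add, map_add, map_add, hx, hy, add_zero]
  · intro a x _ hx
    rw [mul_smul_comm, map_smul, map_smul, hx, smul_zero]

/-- The sandpile group is the kernel of the weight map on the sand dune group. -/
theorem exists_sandpile_hom (d : ℤ) : ∃ j : Sandpile n d →+ Dune n d, Function.Injective j ∧
    ∀ x, duneWeight n d x = 0 ↔ ∃ z, j z = x := by
  refine ⟨((Submodule.comap (ZSpan n).subtype (FSpan n d)).liftQ (toDune n d)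
    (ker_toDune d).ge).toAddMonoidHom, ?_, fun x => ⟨fun hx => ?_, ?_⟩⟩
  · have := LinearMap.ker_eq_bot.1 (Submodule.ker_liftQ_eq_bot _ (toDune n d)
      (ker_toDune d).ge (ker_toDune d).le)
    exact this
  · obtain ⟨z, rfl⟩ := exists_toDune_eq d x hx
    exact ⟨Submodule.Quotient.mk z, rfl⟩
  · rintro ⟨z, rfl⟩
    obtain ⟨z, rfl⟩ := Submodule.Quotient.mk_surjective _ z
    exact duneWeight_toDune d z

end Dune

/-- The number of elements killed by `t` in the kernel of a homomorphism. -/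
def kerTorsCard {G B : Type*} [AddCommGroup G] [AddCommGroup B] (f : G →+ B) (t : ℕ) : ℕ :=
  Nat.card {x : G // t • x = 0 ∧ f x = 0}

theorem torsCard_sandpile {n : ℕ} [NeZero n] (d : ℤ) (t : ℕ) :
    torsCard (Sandpile n d) t = kerTorsCard (duneWeight n d).toAddMonoidHom t := by
  obtain ⟨j, hj, hj'⟩ := exists_sandpile_hom (n := n) d
  refine Nat.card_congr (Equiv.ofBijective (fun x => ⟨j x.1, by rw [← map_nsmul, x.2, map_zero],
    (hj' _).2 ⟨_, rfl⟩⟩) ⟨fun x y hxy => ?_, ?_⟩)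
  · exact Subtype.ext (hj (congrArg Subtype.val hxy))
  · rintro ⟨y, hy, hy'⟩
    obtain ⟨z, rfl⟩ := (hj' y).1 hy'
    exact ⟨⟨z, hj (by rw [map_nsmul, hy, map_zero])⟩, rfl⟩

theorem nsmul_eq_zero_of_coprime {G : Type*} [AddCommGroup G] {x : G} {s t : ℕ}
    (h : Nat.Coprime s t) (hs : s • x = 0) (ht : t • x = 0) : x = 0 := by
  have h1 := addOrderOf_dvd_of_nsmul_eq_zero hs
  have h2 := addOrderOf_dvd_of_nsmul_eq_zero ht
  have h3 := Nat.dvd_gcd h1 h2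
  rw [h, Nat.dvd_one, AddMonoid.addOrderOf_eq_one_iff] at h3
  exact h3

theorem exists_nsmul_eq_self {s t : ℕ} (h : Nat.Coprime s t) :
    ∃ a : ℕ, ∀ {G : Type*} [AddCommGroup G] (x : G), t • x = 0 → (a * s) • x = x := by
  have h1 : Int.gcd (s : ℤ) t = 1 := by simpa using h
  by_cases ht : t = 0
  · subst ht
    rw [Nat.coprime_zero_right] at h
    exact ⟨1, fun x _ => by simp [h]⟩
  obtain ⟨a, ha⟩ : ∃ a : ℕ, a * s ≡ 1 [MOD t] := by
    have : NeZero t := ⟨ht⟩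
    refine ⟨((s : ZMod t)⁻¹).val, ?_⟩
    rw [← ZMod.natCast_eq_natCast_iff]
    push_cast
    rw [ZMod.natCast_zmod_val, mul_comm, ZMod.coe_mul_inv_eq_one s h]
  refine ⟨a, fun {G} _ x hx => ?_⟩
  have h2 := (ha.of_dvd (addOrderOf_dvd_of_nsmul_eq_zero hx))
  have h3 := nsmul_eq_nsmul_iff_modEq.2 h2
  rwa [one_nsmul] at h3

theorem kerTorsCard_congr {X Y B C : Type*} [AddCommGroup X] [AddCommGroup Y] [AddCommGroup B]
    [AddCommGroup C] {f : X →+ Y} {wX : X →+ B} {wY : Y →+ C} {q E : ℕ} (hE : Nat.Coprime E q)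
    (hker : ∀ x, f x = 0 → E • x = 0) (hsurj : Function.Surjective f)
    (hw : ∀ x, q • x = 0 → (wX x = 0 ↔ wY (f x) = 0)) :
    kerTorsCard wX q = kerTorsCard wY q := by
  refine Nat.card_congr (Equiv.ofBijective (fun x => ⟨f x.1, by rw [← map_nsmul, x.2.1, map_zero],
    (hw _ x.2.1).1 x.2.2⟩) ⟨fun x y hxy => ?_, ?_⟩)
  · have h1 : f (x.1 - y.1) = 0 := by
      rw [map_sub, sub_eq_zero]
      exact congrArg Subtype.val hxy
    refine Subtype.ext (sub_eq_zero.1 (nsmul_eq_zero_of_coprime hE (hker _ h1) ?_))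
    rw [nsmul_sub, x.2.1, y.2.1, sub_zero]
  · rintro ⟨y, hy, hy'⟩
    obtain ⟨x, rfl⟩ := hsurj y
    obtain ⟨a, ha⟩ := exists_nsmul_eq_self hE
    have h1 : q • (a * E) • x = 0 := by
      have h3 : E • q • x = 0 := hker _ (by rw [map_nsmul, hy])
      have h4 : q • (a * E) • x = a • E • q • x := by
        simp only [smul_smul]
        congr 1
        ring
      rw [h4, h3, smul_zero]
    have h2 : f ((a * E) • x) = f x := by rw [map_nsmul, ha _ hy]
    exact ⟨⟨(a * E) • x, h1, (hw _ h1).2 (by rw [h2, hy'])⟩, Subtype.ext h2⟩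

theorem kerTorsCard_mul_card_map {G B : Type*} [AddCommGroup G] [AddCommGroup B] (f : G →+ B)
    (t : ℕ) :
    kerTorsCard f t * Nat.card ((nsmulAddMonoidHom (α := G) t).ker.map f) = torsCard G t := by
  have h := AddSubgroup.card_eq_card_quotient_mul_card_addSubgroup
    (f.comp (nsmulAddMonoidHom (α := G) t).ker.subtype).ker
  rw [Nat.card_congr (QuotientAddGroup.quotientKerEquivRange _).toEquiv] at h
  have h1 : (f.comp (nsmulAddMonoidHom (α := G) t).ker.subtype).range =
      (nsmulAddMonoidHom (α := G) t).ker.map f := by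
    rw [AddMonoidHom.range_comp, AddSubgroup.range_subtype]
  have h2 : Nat.card (f.comp (nsmulAddMonoidHom (α := G) t).ker.subtype).ker =
      kerTorsCard f t :=
    Nat.card_congr ⟨fun x => ⟨x.1.1, x.1.2, x.2⟩, fun x => ⟨⟨x.1, x.2.1⟩, x.2.2⟩, fun _ => rfl,
      fun _ => rfl⟩
  rw [h1, h2, mul_comm] at h
  exact h.symm

theorem card_addSubgroup_zmod {m t : ℕ} [NeZero m] (ht : t ∣ m) (S : AddSubgroup (ZMod m))
    (h1 : ∀ x ∈ S, t • x = 0) (h2 : ∃ x ∈ S, addOrderOf x = t) : Nat.card S = t := by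
  apply le_antisymm
  · have h3 : torsCard (ZMod m) t = t := by
      rw [torsCard_zmod (NeZero.ne m), Nat.gcd_eq_left ht]
    rw [← h3]
    exact Nat.card_le_card_of_injective (fun x : S => (⟨x.1, h1 _ x.2⟩ : {x : ZMod m // t • x = 0}))
      fun x y hxy => Subtype.ext (Subtype.mk.inj hxy)
  · obtain ⟨x, hx, rfl⟩ := h2
    rw [← Nat.card_zmultiples]
    exact AddSubgroup.card_le_of_le (AddSubgroup.zmultiples_le_of_mem hx)

section Orbit

variable {m : ℕ} {d : ℤ}

theorem isUnit_intCast_zmod (hcop : Nat.gcd m d.natAbs = 1) : IsUnit (d : ZMod m) := by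
  rw [ZMod.coe_int_isUnit_iff_isCoprime, Int.isCoprime_iff_gcd_eq_one]
  simpa [Int.gcd] using hcop

theorem dvd_of_pow_mul_eq {v : ZMod m} {o : ℕ} (ho : 0 < o ∧ (d : ZMod m) ^ o * v = v ∧
    ∀ e : ℕ, 0 < e → (d : ZMod m) ^ e * v = v → o ≤ e) {e : ℕ} (he : (d : ZMod m) ^ e * v = v) :
    o ∣ e := by
  have h1 : ∀ j : ℕ, (d : ZMod m) ^ (o * j) * v = v := by
    intro j
    induction j with
    | zero => simp
    | succ j ih => rw [Nat.mul_succ, pow_add, mul_assoc, ho.2.1, ih]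
  have h2 : (d : ZMod m) ^ (e % o) * v = v := by
    have h3 : (d : ZMod m) ^ e * v = (d : ZMod m) ^ (e % o) * v := by
      conv_lhs => rw [← Nat.mod_add_div e o, pow_add, mul_assoc, h1]
    rw [← h3, he]
  by_contra hne
  have h4 : 0 < e % o := Nat.pos_of_ne_zero fun h => hne (Nat.dvd_of_mod_eq_zero h)
  exact absurd (ho.2.2 _ h4 h2) (not_le.2 (Nat.mod_lt _ ho.1))

theorem pow_eq_pow_of_mul_eq (hcop : Nat.gcd m d.natAbs = 1) {v : ZMod m} {o : ℕ}
    (ho : 0 < o ∧ (d : ZMod m) ^ o * v = v ∧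
    ∀ e : ℕ, 0 < e → (d : ZMod m) ^ e * v = v → o ≤ e) {i j : ℕ}
    (h : (d : ZMod m) ^ i * v = (d : ZMod m) ^ j * v) :
    (d : ZMod (d ^ o - 1).natAbs) ^ i = (d : ZMod (d ^ o - 1).natAbs) ^ j := by
  wlog hij : i ≤ j generalizing i j
  · exact (this h.symm (le_of_not_ge hij)).symm
  obtain ⟨e, rfl⟩ := Nat.exists_eq_add_of_le hij
  rw [pow_add, mul_assoc] at h
  have h1 := ((isUnit_intCast_zmod hcop).pow i).mul_left_cancel h
  obtain ⟨c, rfl⟩ := dvd_of_pow_mul_eq ho h1.symm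
  have h2 : (d : ZMod (d ^ o - 1).natAbs) ^ o = 1 := by
    rw [← sub_eq_zero]
    have := (ZMod.intCast_zmod_eq_zero_iff_dvd (d ^ o - 1) (d ^ o - 1).natAbs).2
      (Int.natAbs_dvd_self)
    simpa using this
  rw [pow_add, pow_mul, h2, one_pow, mul_one]

open Classical in
/-- The coordinate of `w` along the orbit of `v`: the value `d ^ i` if `w = d ^ i * v`, and `0` if
`w` is not in the orbit of `v`. -/
def orbitCoord (d : ℤ) (o : ℕ) (v w : ZMod m) : ZMod (d ^ o - 1).natAbs :=
  if h : ∃ i : ℕ, (d : ZMod m) ^ i * v = w then (d : ZMod (d ^ o - 1).natAbs) ^ h.choose else 0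

theorem orbitCoord_pow_mul (hcop : Nat.gcd m d.natAbs = 1) {v : ZMod m} {o : ℕ}
    (ho : 0 < o ∧ (d : ZMod m) ^ o * v = v ∧
    ∀ e : ℕ, 0 < e → (d : ZMod m) ^ e * v = v → o ≤ e) (i : ℕ) :
    orbitCoord d o v ((d : ZMod m) ^ i * v) = (d : ZMod (d ^ o - 1).natAbs) ^ i := by
  have h : ∃ j : ℕ, (d : ZMod m) ^ j * v = (d : ZMod m) ^ i * v := ⟨i, rfl⟩
  rw [orbitCoord, dif_pos h]
  exact pow_eq_pow_of_mul_eq hcop ho h.choose_spec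

theorem orbitCoord_of_not_exists {v w : ZMod m} {o : ℕ}
    (h : ¬ ∃ i : ℕ, (d : ZMod m) ^ i * v = w) : orbitCoord d o v w = 0 := by
  rw [orbitCoord, dif_neg h]

theorem orbitCoord_mul (hcop : Nat.gcd m d.natAbs = 1) {v : ZMod m} {o : ℕ}
    (ho : 0 < o ∧ (d : ZMod m) ^ o * v = v ∧
    ∀ e : ℕ, 0 < e → (d : ZMod m) ^ e * v = v → o ≤ e) (w : ZMod m) :
    orbitCoord d o v ((d : ZMod m) * w) = d • orbitCoord d o v w := by
  by_cases h : ∃ i : ℕ, (d : ZMod m) ^ i * v = w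
  · obtain ⟨i, rfl⟩ := h
    rw [← mul_assoc, ← pow_succ', orbitCoord_pow_mul hcop ho, orbitCoord_pow_mul hcop ho, pow_succ',
      zsmul_eq_mul]
  · rw [orbitCoord_of_not_exists h, smul_zero, orbitCoord_of_not_exists]
    rintro ⟨j, hj⟩
    refine h ⟨j + (o - 1), (isUnit_intCast_zmod hcop).mul_left_cancel ?_⟩
    rw [← hj, ← mul_assoc, ← pow_succ', add_assoc, Nat.sub_add_cancel ho.1, pow_add, mul_assoc,
      ho.2.1]

/-- The homomorphism `∏ ℤ/D_v → ℤ/m` sending the generator at `v` to `v`. -/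
def orbitWeight (V : Finset (ZMod m)) (D : V → ℕ) (h : ∀ v : V, D v • (v : ZMod m) = 0) :
    (∀ v : V, ZMod (D v)) →+ ZMod m :=
  ∑ v : V, (ZMod.lift (D v) ⟨zmultiplesHom (ZMod m) (v : ZMod m), by
    simpa using h v⟩).comp (Pi.evalAddMonoidHom _ v)

theorem orbitWeight_apply (V : Finset (ZMod m)) (D : V → ℕ)
    (h : ∀ v : V, D v • (v : ZMod m) = 0) (x : V → ℤ) :
    orbitWeight V D h (fun v => (x v : ZMod (D v))) = ∑ v : V, x v • (v : ZMod m) := by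
  rw [orbitWeight, AddMonoidHom.finsetSum_apply]
  refine Finset.sum_congr rfl fun v _ => ?_
  simp

theorem natAbs_smul_eq_zero {v : ZMod m} {o : ℕ} (ho : (d : ZMod m) ^ o * v = v) :
    (d ^ o - 1).natAbs • v = 0 := by
  have h1 : (d ^ o - 1) • v = 0 := by
    rw [zsmul_eq_mul]
    push_cast
    rw [sub_mul, ho, one_mul, sub_self]
  rcases Int.natAbs_eq (d ^ o - 1) with h | h
  · rw [h] at h1
    simpa using h1
  · rw [h, neg_smul, neg_eq_zero] at h1
    simpa using h1

end Orbit

theorem natAbs_smul_eq_zero_iff {G : Type*} [AddCommGroup G] (a : ℤ) (x : G) :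
    a.natAbs • x = 0 ↔ a • x = 0 := by
  rcases Int.natAbs_eq a with h | h
  · conv_rhs => rw [h, natCast_zsmul]
  · conv_rhs => rw [h, neg_smul, neg_eq_zero, natCast_zsmul]

theorem mk_single_zero (n : ℕ) (d : ℤ) :
    (duneRel n d).mkQ (Finsupp.single 0 1) = 0 :=
  (Submodule.Quotient.mk_eq_zero _).2
    (Submodule.mem_sup_right (Submodule.mem_span_singleton_self _))

theorem mk_single_pow_mul (n : ℕ) (d : ℤ) (v : ZMod n) (i : ℕ) :
    (duneRel n d).mkQ (Finsupp.single ((d : ZMod n) ^ i * v) 1) =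
      d ^ i • (duneRel n d).mkQ (Finsupp.single v 1) := by
  induction i with
  | zero => simp
  | succ i ih =>
    rw [pow_succ', mul_assoc, pow_succ', mul_smul, ← ih, ← map_smul, eq_comm, ← sub_eq_zero,
      ← map_sub, Submodule.mkQ_apply, Submodule.Quotient.mk_eq_zero, ← duneMap_single]
    exact Submodule.mem_sup_left ⟨_, rfl⟩

theorem pow_mul_eq_zero_of_castHom {n m : ℕ} (hmn : m ∣ n) {d : ℤ} {K : ℕ}
    (hK : n ∣ d.natAbs ^ K * m) {x : ZMod n} (hx : ZMod.castHom hmn (ZMod m) x = 0) :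
    (d : ZMod n) ^ K * x = 0 := by
  obtain ⟨a, rfl⟩ := ZMod.intCast_surjective x
  rw [map_intCast, ZMod.intCast_zmod_eq_zero_iff_dvd] at hx
  have : (((d ^ K * a : ℤ)) : ZMod n) = 0 := by
    rw [ZMod.intCast_zmod_eq_zero_iff_dvd]
    have h1 : (n : ℤ) ∣ d ^ K * m := by
      rw [← Int.natAbs_dvd_natAbs]
      simpa [Int.natAbs_mul, Int.natAbs_pow] using hK
    exact h1.trans (mul_dvd_mul_left _ hx)
  simpa using this

theorem pow_mul_eq_pow_mul_of_castHom {n m : ℕ} (hmn : m ∣ n) {d : ℤ} {K : ℕ}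
    (hK : n ∣ d.natAbs ^ K * m) {x y : ZMod n}
    (hx : ZMod.castHom hmn (ZMod m) x = ZMod.castHom hmn (ZMod m) y) :
    (d : ZMod n) ^ K * x = (d : ZMod n) ^ K * y := by
  rw [← sub_eq_zero, ← mul_sub]
  exact pow_mul_eq_zero_of_castHom hmn hK (by rw [map_sub, hx, sub_self])

theorem exists_orbit_hom {n m : ℕ} [NeZero n] (hmn : m ∣ n) {d : ℤ}
    (hcop : Nat.gcd m d.natAbs = 1) {K : ℕ} (hK : n ∣ d.natAbs ^ K * m)
    {V : Finset (ZMod m)} (h0 : (0 : ZMod m) ∉ V)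
    (hcover : ∀ w : ZMod m, w ≠ 0 → ∃ v ∈ V, ∃ i : ℕ, (d : ZMod m) ^ i * v = w)
    (hsep : ∀ v ∈ V, ∀ v' ∈ V, (∃ i : ℕ, (d : ZMod m) ^ i * v = v') → v = v')
    (o : ZMod m → ℕ)
    (ho : ∀ w : ZMod m, 0 < o w ∧ (d : ZMod m) ^ (o w) * w = w ∧
      ∀ e : ℕ, 0 < e → (d : ZMod m) ^ e * w = w → o w ≤ e)
    (hD : ∀ v : V, (d ^ o v - 1).natAbs • (v : ZMod m) = 0) :
    ∃ ψ : Dune n d →+ ∀ v : V, ZMod (d ^ o v - 1).natAbs, Function.Surjective ψ ∧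
      (∀ x, ψ x = 0 → d.natAbs ^ K • x = 0) ∧
      ∀ x, orbitWeight V _ hD (ψ x) = ZMod.castHom hmn (ZMod m) (duneWeight n d x) := by
  classical
  have hval : ∀ v ∈ V, ∀ v' ∈ V, ∀ i : ℕ, v' ≠ v →
      orbitCoord d (o v') v' ((d : ZMod m) ^ i * v) = 0 := by
    intro v hv v' hv' i hne
    refine orbitCoord_of_not_exists ?_
    rintro ⟨j, hj⟩
    refine hne (hsep v' hv' v hv ?_)
    have h1 : ∀ s : ℕ, (d : ZMod m) ^ (o v * s) * v = v := by
      intro s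
      induction s with
      | zero => simp
      | succ s ih => rw [Nat.mul_succ, pow_add, mul_assoc, (ho v).2.1, ih]
    refine ⟨j + (o v * i - i), ((isUnit_intCast_zmod hcop).pow i).mul_left_cancel ?_⟩
    have h2 : i ≤ o v * i := Nat.le_mul_of_pos_left _ (ho v).1
    rw [← mul_assoc, ← pow_add, show i + (j + (o v * i - i)) = o v * i + j by omega, pow_add,
      mul_assoc, hj, ← mul_assoc, mul_comm _ ((d : ZMod m) ^ i), mul_assoc, h1]
  let g : ZMod n → ∀ v : V, ZMod (d ^ o v - 1).natAbs := fun w v =>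
    orbitCoord d (o v) v (ZMod.castHom hmn (ZMod m) w)
  let G := Finsupp.linearCombination ℤ g
  have hG1 : ∀ w, G (Finsupp.single w 1) = g w := fun w => by simp [G]
  have hg0 : ∀ w, ZMod.castHom hmn (ZMod m) w = 0 → g w = 0 := by
    intro w hw
    funext v
    change orbitCoord d (o v) v (ZMod.castHom hmn (ZMod m) w) = 0
    rw [hw]
    refine orbitCoord_of_not_exists ?_
    rintro ⟨i, hi⟩
    rw [((isUnit_intCast_zmod hcop).pow i).mul_right_eq_zero] at hi
    exact h0 (hi ▸ v.2)
  have hgd : ∀ w, g ((d : ZMod n) * w) = d • g w := by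
    intro w
    funext v
    change orbitCoord d (o v) v (ZMod.castHom hmn (ZMod m) ((d : ZMod n) * w)) =
      d • orbitCoord d (o v) v (ZMod.castHom hmn (ZMod m) w)
    rw [map_mul, map_intCast, orbitCoord_mul hcop (ho v)]
  have hgv : ∀ v : V, ∀ i : ℕ, ∀ w, (d : ZMod m) ^ i * v = ZMod.castHom hmn (ZMod m) w →
      g w = Pi.single v ((d : ZMod (d ^ o v - 1).natAbs) ^ i) := by
    intro v i w hw
    funext v'
    change orbitCoord d (o v') v' (ZMod.castHom hmn (ZMod m) w) = _
    rw [← hw]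
    by_cases h : v' = v
    · subst h
      rw [orbitCoord_pow_mul hcop (ho _), Pi.single_eq_same]
    · rw [hval v v.2 v' v'.2 i (fun h' => h (Subtype.ext h')), Pi.single_eq_of_ne h]
  have hG : duneRel n d ≤ LinearMap.ker G := by
    refine sup_le ?_ ?_
    · rintro _ ⟨y, rfl⟩
      have : G ∘ₗ duneMap n d = 0 := by
        refine Finsupp.lhom_ext' fun w => LinearMap.ext_ring ?_
        change G (duneMap n d (Finsupp.single w 1)) = 0
        rw [duneMap_single, map_sub, map_smul, hG1, hG1, hgd, sub_self]
      exact LinearMap.congr_fun this y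
    · rw [Submodule.span_le]
      rintro _ rfl
      change G (Finsupp.single 0 1) = 0
      rw [hG1, hg0 _ (map_zero _)]
  let ψ := (duneRel n d).liftQ G hG
  have hψ : ∀ w, ψ ((duneRel n d).mkQ (Finsupp.single w 1)) = g w := hG1
  choose L hL using fun v : V => ZMod.castHom_surjective hmn (v : ZMod m)
  refine ⟨ψ.toAddMonoidHom, ?_, ?_, ?_⟩
  · intro y
    refine ⟨∑ v : V, (ZMod.cast (y v) : ℤ) • (duneRel n d).mkQ (Finsupp.single (L v) 1), ?_⟩
    rw [LinearMap.toAddMonoidHom_coe, map_sum]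
    conv_rhs => rw [← Finset.univ_sum_single y]
    refine Finset.sum_congr rfl fun v _ => ?_
    rw [map_smul, hψ, hgv v 0 _ (by rw [pow_zero, one_mul, hL]), pow_zero, ← Pi.single_smul]
    simp
  · let σ : (∀ v : V, ZMod (d ^ o v - 1).natAbs) →+ Dune n d :=
      ∑ v : V, (ZMod.lift (d ^ o v - 1).natAbs ⟨zmultiplesHom (Dune n d)
        (d ^ K • (duneRel n d).mkQ (Finsupp.single (L v) 1)), by
          have h1 : (d ^ o v - 1) • d ^ K • (duneRel n d).mkQ (Finsupp.single (L v) 1) = 0 := by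
            rw [sub_smul, smul_smul, ← pow_add, add_comm, one_smul, ← mk_single_pow_mul,
              ← mk_single_pow_mul, pow_add, mul_assoc, sub_eq_zero]
            congr 2
            refine pow_mul_eq_pow_mul_of_castHom hmn hK ?_
            rw [map_mul, map_pow, map_intCast, hL, (ho v).2.1]
          rw [← natAbs_smul_eq_zero_iff] at h1
          simpa using h1⟩).comp (Pi.evalAddMonoidHom _ v)
    have hσ : ∀ (v : V) (a : ℤ), σ (Pi.single v (a : ZMod (d ^ o v - 1).natAbs)) =
        a • d ^ K • (duneRel n d).mkQ (Finsupp.single (L v) 1) := by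
      intro v a
      rw [AddMonoidHom.finsetSum_apply, Finset.sum_eq_single v]
      · simp
      · intro v' _ hne
        simp [Pi.single_eq_of_ne hne]
      · simp
    have key : σ.toIntLinearMap ∘ₗ ψ ∘ₗ (duneRel n d).mkQ = d ^ K • (duneRel n d).mkQ := by
      refine Finsupp.lhom_ext' fun w => LinearMap.ext_ring ?_
      change σ (ψ ((duneRel n d).mkQ (Finsupp.single w 1))) =
        d ^ K • (duneRel n d).mkQ (Finsupp.single w 1)
      rw [hψ, ← mk_single_pow_mul]
      by_cases hw : ZMod.castHom hmn (ZMod m) w = 0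
      · rw [hg0 w hw, map_zero, pow_mul_eq_zero_of_castHom hmn hK hw, mk_single_zero]
      · obtain ⟨v, hv, i, hi⟩ := hcover _ hw
        have h1 := hσ ⟨v, hv⟩ (d ^ i)
        rw [Int.cast_pow] at h1
        rw [hgv ⟨v, hv⟩ i w hi, h1, smul_comm, ← mk_single_pow_mul, ← mk_single_pow_mul]
        congr 2
        refine pow_mul_eq_pow_mul_of_castHom hmn hK ?_
        rw [map_mul, map_pow, map_intCast, hL, hi]
    intro x hx
    obtain ⟨y, rfl⟩ := (duneRel n d).mkQ_surjective x
    have h1 := LinearMap.congr_fun key y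
    have h2 : ψ ((duneRel n d).mkQ y) = 0 := hx
    have h3 : σ (ψ ((duneRel n d).mkQ y)) = d ^ K • (duneRel n d).mkQ y := h1
    rw [h2, map_zero] at h3
    rw [← Int.natAbs_pow, natAbs_smul_eq_zero_iff, ← h3]
  · intro x
    obtain ⟨y, rfl⟩ := (duneRel n d).mkQ_surjective x
    have key : (orbitWeight V _ hD).toIntLinearMap ∘ₗ G =
        (ZMod.castHom hmn (ZMod m)).toAddMonoidHom.toIntLinearMap ∘ₗ weight n := by
      refine Finsupp.lhom_ext' fun w => LinearMap.ext_ring ?_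
      change orbitWeight V _ hD (G (Finsupp.single w 1)) =
        ZMod.castHom hmn (ZMod m) (weight n (Finsupp.single w 1))
      rw [hG1, weight_single, one_smul]
      by_cases hw : ZMod.castHom hmn (ZMod m) w = 0
      · rw [hg0 w hw, hw, map_zero]
      · obtain ⟨v, hv, i, hi⟩ := hcover _ hw
        have h1 : g w = fun v' : V =>
            (((Pi.single ⟨v, hv⟩ (d ^ i) : V → ℤ) v' : ℤ) : ZMod (d ^ o v' - 1).natAbs) := by
          rw [hgv ⟨v, hv⟩ i w hi]
          funext v'
          by_cases h : v' = ⟨v, hv⟩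
          · subst h
            simp
          · rw [Pi.single_eq_of_ne h, Pi.single_eq_of_ne h, Int.cast_zero]
        rw [h1, orbitWeight_apply, Finset.sum_eq_single ⟨v, hv⟩, Pi.single_eq_same, ← hi,
          zsmul_eq_mul, Int.cast_pow]
        · intro v' _ hne
          rw [Pi.single_eq_of_ne hne, zero_smul]
        · simp
    exact LinearMap.congr_fun key y

theorem dSeq_succ_mul (n : ℕ) (d : ℤ) (i : ℕ) :
    dSeq n d (i + 1) * Nat.gcd (dSeq n d i) d.natAbs = dSeq n d i :=
  Nat.div_mul_cancel (Nat.gcd_dvd_left _ _)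

theorem dSeq_pos {n : ℕ} (hn : 0 < n) (d : ℤ) (i : ℕ) : 0 < dSeq n d i := by
  induction i with
  | zero => exact hn
  | succ i ih =>
    rw [← dSeq_succ_mul n d i] at ih
    exact Nat.pos_of_mul_pos_right ih

theorem dSeq_dvd (n : ℕ) (d : ℤ) (i : ℕ) : dSeq n d i ∣ n := by
  induction i with
  | zero => exact dvd_rfl
  | succ i ih => exact (Dvd.intro _ (dSeq_succ_mul n d i)).trans ih

theorem dvd_pow_mul_dSeq (n : ℕ) (d : ℤ) (i : ℕ) : n ∣ d.natAbs ^ i * dSeq n d i := by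
  induction i with
  | zero => simp [dSeq]
  | succ i ih =>
    refine ih.trans ?_
    rw [pow_succ, mul_assoc, ← dSeq_succ_mul n d i, mul_comm (dSeq n d (i + 1))]
    exact mul_dvd_mul_left _ (mul_dvd_mul_right (Nat.gcd_dvd_right _ _) _)

theorem dSeq_dSeq_one (n : ℕ) (d : ℤ) (i : ℕ) : dSeq (dSeq n d 1) d i = dSeq n d (i + 1) := by
  induction i with
  | zero => rfl
  | succ i ih => exact congrArg (fun a => a / Nat.gcd a d.natAbs) ih

theorem pow_sub_one_natAbs_ne_zero {d : ℤ} (hd : 2 ≤ |d|) {o : ℕ} (ho : 0 < o) :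
    (d ^ o - 1).natAbs ≠ 0 := by
  rw [Int.natAbs_ne_zero, sub_ne_zero]
  intro h
  have h1 : |d| ^ o = 1 := by rw [← abs_pow, h, abs_one]
  have h2 := one_lt_pow₀ (show 1 < |d| by linarith) ho.ne'
  omega

theorem finite_of_nsmul_eq_zero {M : Type*} [AddCommGroup M] [Module.Finite ℤ M] {N : ℕ}
    (hN : N ≠ 0) (h : ∀ x : M, N • x = 0) : Finite M := by
  refine Module.finite_of_fg_torsion M fun x => ?_
  refine ⟨⟨(N : ℤ), by simpa using hN⟩, ?_⟩
  simpa using h x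

theorem finite_dune {n m : ℕ} [NeZero n] (hmn : m ∣ n) {d : ℤ} (hd : 2 ≤ |d|)
    (hcop : Nat.gcd m d.natAbs = 1) {K : ℕ} (hK : n ∣ d.natAbs ^ K * m)
    {V : Finset (ZMod m)} (h0 : (0 : ZMod m) ∉ V)
    (hcover : ∀ w : ZMod m, w ≠ 0 → ∃ v ∈ V, ∃ i : ℕ, (d : ZMod m) ^ i * v = w)
    (hsep : ∀ v ∈ V, ∀ v' ∈ V, (∃ i : ℕ, (d : ZMod m) ^ i * v = v') → v = v')
    (o : ZMod m → ℕ)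
    (ho : ∀ w : ZMod m, 0 < o w ∧ (d : ZMod m) ^ (o w) * w = w ∧
      ∀ e : ℕ, 0 < e → (d : ZMod m) ^ e * w = w → o w ≤ e) : Finite (Dune n d) := by
  obtain ⟨ψ, -, hker, -⟩ := exists_orbit_hom hmn hcop hK h0 hcover hsep o ho
    (fun v => natAbs_smul_eq_zero (ho v).2.1)
  have h1 : d.natAbs ≠ 0 := by
    intro h
    rw [Int.natAbs_eq_zero] at h
    simp [h] at hd
  refine finite_of_nsmul_eq_zero (N := d.natAbs ^ K * ∏ v : V, (d ^ o v - 1).natAbs)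
    (mul_ne_zero (pow_ne_zero _ h1)
      (Finset.prod_ne_zero_iff.2 fun v _ => pow_sub_one_natAbs_ne_zero hd (ho v).1)) fun x => ?_
  rw [mul_smul]
  apply hker
  rw [map_nsmul]
  funext v
  rw [Pi.smul_apply, ← Finset.prod_erase_mul _ _ (mem_univ v), mul_smul]
  simp

theorem finite_sandpile {n : ℕ} [NeZero n] {d : ℤ} [Finite (Dune n d)] :
    Finite (Sandpile n d) := by
  obtain ⟨j, hj, -⟩ := exists_sandpile_hom (n := n) d
  exact Finite.of_injective j hj

theorem padicValNat_pow_prime_pow_sub_one {p : ℕ} [hp : Fact p.Prime] {s : ℤ} {t : ℕ}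
    (hs : s - 1 ≠ 0) (hst : s ^ p ^ t - 1 ≠ 0) (h : (p : ℤ) ∣ s - 1) (h2 : p = 2 → 4 ∣ s - 1) :
    padicValNat p (s ^ p ^ t - 1).natAbs = padicValNat p (s - 1).natAbs + t := by
  have hps : ¬ (p : ℤ) ∣ s := by
    intro h3
    have h4 := dvd_sub h3 h
    rw [sub_sub_cancel, Int.natCast_dvd_ofNat] at h4
    exact hp.out.one_lt.ne' (Nat.dvd_one.1 h4)
  have key : emultiplicity (p : ℤ) (s ^ p ^ t - 1) = emultiplicity (p : ℤ) (s - 1) + t := by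
    rcases hp.out.eq_two_or_odd' with h3 | h3
    · have h4 := Int.two_pow_sub_pow' (y := 1) (p ^ t) (h2 h3) (by simpa [h3] using hps)
      rw [one_pow] at h4
      subst h3
      push_cast at h4
      rw [emultiplicity_pow_self (by norm_num)
        (by rw [Int.isUnit_iff]; norm_num)] at h4
      exact_mod_cast h4
    · have h4 := Int.emultiplicity_pow_sub_pow hp.out h3 (y := 1) h hps (p ^ t)
      rw [one_pow, emultiplicity_pow_self hp.out.ne_zero
        (by simpa using hp.out.ne_one)] at h4
      exact h4
  have h5 : ∀ z : ℤ, z ≠ 0 → ((padicValNat p z.natAbs : ℕ) : ℕ∞) = emultiplicity (p : ℤ) z := by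
    intro z hz
    rw [padicValNat_eq_emultiplicity (by simpa using hz), ← Int.emultiplicity_natAbs]
  rw [← h5 _ hs, ← h5 _ hst] at key
  exact_mod_cast key

theorem gcd_prime_pow_eq {p N : ℕ} [hp : Fact p.Prime] (hN : N ≠ 0) (b : ℕ) :
    Nat.gcd (p ^ b) N = p ^ min b (padicValNat p N) := by
  obtain ⟨j, hj, hj'⟩ := (Nat.dvd_prime_pow hp.out).1 (Nat.gcd_dvd_left (p ^ b) N)
  rw [hj']
  congr 1
  have h1 : p ^ j ∣ N := hj' ▸ Nat.gcd_dvd_right _ _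
  apply le_antisymm
  · exact le_min hj ((padicValNat_dvd_iff_le hN).1 h1)
  · rw [← Nat.pow_dvd_pow_iff_le_right hp.out.one_lt, ← hj']
    exact Nat.dvd_gcd (pow_dvd_pow _ (min_le_left _ _))
      ((padicValNat_dvd_iff_le hN).2 (min_le_right _ _))

theorem addOrderOf_div_prime_pow {m p j : ℕ} (hm : m ≠ 0) (h : p ^ j ∣ m) :
    addOrderOf ((m / p ^ j : ℕ) : ZMod m) = p ^ j := by
  rw [ZMod.addOrderOf_coe _ hm, Nat.gcd_eq_right (Nat.div_dvd_of_dvd h)]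
  exact Nat.div_div_self h hm

theorem pow_mul_eq_self_iff {m : ℕ} {d : ℤ} {e : ℕ} {v : ZMod m} :
    (d : ZMod m) ^ e * v = v ↔ addOrderOf v ∣ (d ^ e - 1).natAbs := by
  rw [addOrderOf_dvd_iff_nsmul_eq_zero, natAbs_smul_eq_zero_iff, zsmul_eq_mul]
  push_cast
  rw [sub_mul, one_mul, sub_eq_zero]

theorem padicValNat_orbit_le {m p ν j o' : ℕ} [hp : Fact p.Prime] {d : ℤ} (hd : 2 ≤ |d|)
    {w : ZMod m} {o : ℕ} (hw : addOrderOf w = p ^ ν)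
    (ho : 0 < o ∧ (d : ZMod m) ^ o * w = w ∧ ∀ e : ℕ, 0 < e → (d : ZMod m) ^ e * w = w → o ≤ e)
    (ho' : 0 < o') (hj0 : 1 ≤ j) (hj : j ≤ ν) (hdvd : p ^ j ∣ (d ^ o' - 1).natAbs)
    (h2 : p = 2 → 4 ∣ d ^ o' - 1 ∨ j = ν) :
    padicValNat p (d ^ o - 1).natAbs ≤ padicValNat p (d ^ o' - 1).natAbs + (ν - j) := by
  have hne := pow_sub_one_natAbs_ne_zero hd ho'
  have hpos : 0 < o' * p ^ (ν - j) := Nat.mul_pos ho' (pow_pos hp.out.pos _)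
  have hne' := pow_sub_one_natAbs_ne_zero hd hpos
  have hval : padicValNat p (d ^ (o' * p ^ (ν - j)) - 1).natAbs =
      padicValNat p (d ^ o' - 1).natAbs + (ν - j) := by
    rcases Nat.eq_zero_or_pos (ν - j) with h0 | h0
    · simp [h0]
    · rw [pow_mul]
      rw [pow_mul] at hne'
      refine padicValNat_pow_prime_pow_sub_one (by simpa using hne) (by simpa using hne') ?_
        fun h => (h2 h).resolve_right (by omega)
      exact Int.natCast_dvd.2 ((dvd_pow_self p (by omega)).trans hdvd)
  have hj' := (padicValNat_dvd_iff_le hne).1 hdvd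
  have h3 : (d : ZMod m) ^ (o' * p ^ (ν - j)) * w = w := by
    rw [pow_mul_eq_self_iff, hw, padicValNat_dvd_iff_le hne', hval]
    omega
  obtain ⟨c, hc⟩ := dvd_of_pow_mul_eq ho h3
  rw [← hval, ← padicValNat_dvd_iff_le hne']
  refine pow_padicValNat_dvd.trans (Int.natAbs_dvd_natAbs.2 ?_)
  rw [hc, pow_mul]
  exact sub_one_dvd_pow_sub_one _ _

theorem pow_smul_orbitWeight_eq_zero {m p ν m' : ℕ} [hp : Fact p.Prime] (hm : m = p ^ ν * m')
    (hm' : Nat.Coprime m' p) {V : Finset (ZMod m)} {D : V → ℕ}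
    (hD : ∀ v : V, D v • (v : ZMod m) = 0) {b e : ℕ}
    (He : ∀ v : V, ∀ j, addOrderOf (m' • (v : ZMod m)) = p ^ j →
      j ≤ e + (padicValNat p (D v) - b)) {x : ∀ v : V, ZMod (D v)} (hx : p ^ b • x = 0) :
    p ^ e • orbitWeight V D hD x = 0 := by
  choose X hX using fun v => ZMod.intCast_surjective (x v)
  obtain rfl : (fun v => (X v : ZMod (D v))) = x := funext hX
  rw [orbitWeight_apply, Finset.smul_sum]
  refine Finset.sum_eq_zero fun v _ => ?_
  have h1 : (D v : ℤ) ∣ (p : ℤ) ^ b * X v := by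
    have h := congrFun hx v
    rw [← ZMod.intCast_zmod_eq_zero_iff_dvd]
    simpa using h
  have h2 : (p : ℤ) ^ (padicValNat p (D v) - b) ∣ X v := by
    rcases le_total (padicValNat p (D v)) b with h | h
    · simp [Nat.sub_eq_zero_of_le h]
    · refine Int.dvd_of_mul_dvd_mul_left (a := (p : ℤ) ^ b) (pow_ne_zero _ (by
        exact_mod_cast hp.out.ne_zero)) ?_
      rw [← pow_add, Nat.add_sub_cancel' h]
      refine Dvd.dvd.trans ?_ h1
      exact_mod_cast pow_padicValNat_dvd
  refine nsmul_eq_zero_of_coprime (s := m') (t := p ^ b) (hm'.pow_right b) ?_ ?_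
  · obtain ⟨j, -, hj⟩ := (Nat.dvd_prime_pow hp.out).1 (addOrderOf_dvd_of_nsmul_eq_zero
      (show p ^ ν • m' • (v : ZMod m) = 0 by rw [smul_smul, ← hm]; simp))
    have h3 : (p : ℤ) ^ j ∣ (p : ℤ) ^ e * X v :=
      (pow_dvd_pow _ (He v j hj)).trans (by rw [pow_add]; exact mul_dvd_mul_left _ h2)
    have h4 : ((p : ℤ) ^ e * X v) • m' • (v : ZMod m) = 0 := by
      rw [← addOrderOf_dvd_iff_zsmul_eq_zero, hj]
      exact_mod_cast h3
    rw [← h4]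
    simp only [zsmul_eq_mul, nsmul_eq_mul]
    push_cast
    ring
  · have h5 : ((p : ℤ) ^ b * X v) • (v : ZMod m) = 0 := by
      obtain ⟨r, hr⟩ := h1
      rw [hr, mul_comm, mul_smul, natCast_zsmul, hD, smul_zero]
    have h6 : p ^ b • p ^ e • X v • (v : ZMod m) = p ^ e • ((p : ℤ) ^ b * X v) • (v : ZMod m) := by
      simp only [zsmul_eq_mul, nsmul_eq_mul]
      push_cast
      ring
    rw [h6, h5, smul_zero]

theorem exists_addOrderOf_orbitWeight {m p j : ℕ} [hp : Fact p.Prime] {V : Finset (ZMod m)}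
    {D : V → ℕ} (hD : ∀ v : V, D v • (v : ZMod m) = 0) (hD0 : ∀ v, D v ≠ 0) (b : ℕ) (v : V)
    (hv : addOrderOf (v : ZMod m) = p ^ j) :
    ∃ x : ∀ v : V, ZMod (D v), p ^ b • x = 0 ∧
      addOrderOf (orbitWeight V D hD x) = p ^ (j - (padicValNat p (D v) - b)) := by
  classical
  obtain ⟨a, ha⟩ := Nat.gcd_dvd_right (p ^ b) (D v)
  have ha0 : a ≠ 0 := fun h => hD0 v (by rw [ha, h, mul_zero])
  have hva : padicValNat p a = padicValNat p (D v) - b := by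
    have h1 := congrArg (padicValNat p) ha
    rw [padicValNat.mul (Nat.gcd_ne_zero_right (hD0 v)) ha0, gcd_prime_pow_eq (hD0 v),
      padicValNat.prime_pow] at h1
    omega
  refine ⟨fun u => (((if u = v then (a : ℤ) else 0 : ℤ)) : ZMod (D u)), ?_, ?_⟩
  · funext u
    by_cases hu : u = v
    · subst hu
      have h2 : D u ∣ p ^ b * a := by
        conv_lhs => rw [ha]
        exact mul_dvd_mul_right (Nat.gcd_dvd_left _ _) _
      have h3 := (ZMod.natCast_eq_zero_iff _ _).2 h2
      simpa using h3
    · simp [hu]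
  · rw [orbitWeight_apply, Finset.sum_eq_single v (fun u _ hu => by simp [hu]) (by simp),
      if_pos rfl, natCast_zsmul, addOrderOf_nsmul' _ ha0, hv, gcd_prime_pow_eq ha0, hva,
      Nat.pow_div (min_le_left _ _) hp.out.pos]
    congr 1
    omega

theorem dvd_addOrderOf_and_prime_dvd {m : ℕ} (hm : m ≠ 0) {d : ℤ} {V : Finset (ZMod m)}
    {c : ZMod m → ℕ}
    (hc1 : ∀ p : ℕ, p.Prime → p ∣ m → (p ≠ 2 ∨ d % 4 = 1 ∨ ¬ (4 ∣ m)) →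
      c ((m / p ^ padicValNat p m : ℕ) : ZMod m) = p ^ padicValNat p m)
    (hc2 : 4 ∣ m → d % 4 = 3 →
      c ((m / 2 ^ padicValNat 2 m : ℕ) : ZMod m) = 2 ^ padicValNat 2 m / 2)
    (hc3 : 4 ∣ m → d % 4 = 3 → c ((m / 2 : ℕ) : ZMod m) = 2)
    (hc4 : ∀ v ∈ V,
      (∀ p : ℕ, p.Prime → p ∣ m → v ≠ ((m / p ^ padicValNat p m : ℕ) : ZMod m)) →
      ((4 ∣ m ∧ d % 4 = 3) → v ≠ ((m / 2 : ℕ) : ZMod m)) → c v = 1)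
    (hd2 : 2 ∣ m → d % 2 = 1) {v : ZMod m} (hv : v ∈ V) :
    c v ∣ addOrderOf v ∧ ∀ p : ℕ, p.Prime → p ∣ c v →
      (p ∣ m ∧ v = ((m / p ^ padicValNat p m : ℕ) : ZMod m)) ∨
      (p = 2 ∧ 4 ∣ m ∧ d % 4 = 3 ∧ v = ((m / 2 : ℕ) : ZMod m)) := by
  by_cases hA : ∃ r : ℕ, r.Prime ∧ r ∣ m ∧ v = ((m / r ^ padicValNat r m : ℕ) : ZMod m)
  · obtain ⟨r, hr, hrm, rfl⟩ := hA
    rw [addOrderOf_div_prime_pow hm pow_padicValNat_dvd]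
    have hcd : c ((m / r ^ padicValNat r m : ℕ) : ZMod m) ∣ r ^ padicValNat r m := by
      by_cases hex : r ≠ 2 ∨ d % 4 = 1 ∨ ¬ (4 ∣ m)
      · rw [hc1 r hr hrm hex]
      · push Not at hex
        obtain ⟨rfl, h1, h4⟩ := hex
        have := hd2 hrm
        rw [hc2 h4 (by omega)]
        exact Nat.div_dvd_of_dvd (dvd_pow_self 2 (Nat.one_le_iff_ne_zero.1
          (one_le_padicValNat_of_dvd hm hrm)))
    refine ⟨hcd, fun p hp hpc => ?_⟩
    obtain rfl := (Nat.prime_dvd_prime_iff_eq hp hr).1 (hp.dvd_of_dvd_pow (hpc.trans hcd))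
    exact Or.inl ⟨hrm, rfl⟩
  · by_cases hB : (4 ∣ m ∧ d % 4 = 3) ∧ v = ((m / 2 : ℕ) : ZMod m)
    · obtain ⟨⟨h4, hd4⟩, rfl⟩ := hB
      have h2 : 2 ^ 1 ∣ m := (by norm_num : (2 ^ 1 : ℕ) ∣ 4).trans h4
      have h3 := addOrderOf_div_prime_pow hm h2
      rw [pow_one] at h3
      rw [h3, hc3 h4 hd4]
      refine ⟨dvd_rfl, fun p hp hpc => Or.inr ⟨(Nat.prime_dvd_prime_iff_eq hp Nat.prime_two).1 hpc,
        h4, hd4, rfl⟩⟩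
    · have h1 : c v = 1 := hc4 v hv (fun p hp hpm h => hA ⟨p, hp, hpm, h⟩) fun h h' => hB ⟨h, h'⟩
      rw [h1]
      exact ⟨one_dvd _, fun p hp h => absurd (Nat.dvd_one.1 h) hp.ne_one⟩

theorem kerTorsCard_orbitWeight_mul {m p ν m' : ℕ} [NeZero m] [hp : Fact p.Prime]
    (hm : m = p ^ ν * m')
    (hm' : Nat.Coprime m' p) {V : Finset (ZMod m)} {D : V → ℕ}
    (hD : ∀ v : V, D v • (v : ZMod m) = 0) (hD0 : ∀ v, D v ≠ 0) {b e : ℕ} (he : e ≤ ν)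
    (He : ∀ v : V, ∀ j, addOrderOf (m' • (v : ZMod m)) = p ^ j →
      j ≤ e + (padicValNat p (D v) - b))
    (hx : ∃ x : ∀ v : V, ZMod (D v), p ^ b • x = 0 ∧
      addOrderOf (orbitWeight V D hD x) = p ^ e) :
    kerTorsCard (orbitWeight V D hD) (p ^ b) * p ^ e = ∏ v : V, Nat.gcd (p ^ b) (D v) := by
  have h1 := kerTorsCard_mul_card_map (orbitWeight V D hD) (p ^ b)
  rw [card_addSubgroup_zmod (t := p ^ e) (hm ▸ dvd_mul_of_dvd_left (pow_dvd_pow p he) m'),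
    torsCard_pi] at h1
  · rw [h1]
    exact Finset.prod_congr rfl fun v _ => torsCard_zmod (hD0 v) _
  · rintro _ ⟨x, hx, rfl⟩
    exact pow_smul_orbitWeight_eq_zero hm hm' hD He hx
  · obtain ⟨x, hx, hx'⟩ := hx
    exact ⟨_, ⟨x, hx, rfl⟩, hx'⟩

theorem gcd_prime_pow_div_eq {p b D c : ℕ} [hp : Fact p.Prime] (hD : D ≠ 0) (hc : c ∣ D) :
    Nat.gcd (p ^ b) (D / c) = p ^ min b (padicValNat p D - padicValNat p c) := by
  rw [gcd_prime_pow_eq (Nat.div_ne_zero_iff_of_dvd hc |>.2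
      ⟨hD, fun h => hD (by simpa [h] using hc)⟩),
    padicValNat.div_of_dvd hc]

theorem kerTorsCard_orbitWeight {m : ℕ} [NeZero m] {d : ℤ} (hd : 2 ≤ |d|)
    (hcop : Nat.gcd m d.natAbs = 1) {V : Finset (ZMod m)}
    (hVstar : ∀ p : ℕ, p.Prime → p ∣ m →
      ∀ j : ℕ, 1 ≤ j → j ≤ padicValNat p m → ((m / p ^ j : ℕ) : ZMod m) ∈ V)
    {o : ZMod m → ℕ}
    (ho : ∀ w : ZMod m, 0 < o w ∧ (d : ZMod m) ^ (o w) * w = w ∧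
      ∀ e : ℕ, 0 < e → (d : ZMod m) ^ e * w = w → o w ≤ e)
    {c : ZMod m → ℕ}
    (hc1 : ∀ p : ℕ, p.Prime → p ∣ m → (p ≠ 2 ∨ d % 4 = 1 ∨ ¬ (4 ∣ m)) →
      c ((m / p ^ padicValNat p m : ℕ) : ZMod m) = p ^ padicValNat p m)
    (hc2 : 4 ∣ m → d % 4 = 3 →
      c ((m / 2 ^ padicValNat 2 m : ℕ) : ZMod m) = 2 ^ padicValNat 2 m / 2)
    (hc3 : 4 ∣ m → d % 4 = 3 → c ((m / 2 : ℕ) : ZMod m) = 2)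
    (hc4 : ∀ v ∈ V,
      (∀ p : ℕ, p.Prime → p ∣ m → v ≠ ((m / p ^ padicValNat p m : ℕ) : ZMod m)) →
      ((4 ∣ m ∧ d % 4 = 3) → v ≠ ((m / 2 : ℕ) : ZMod m)) → c v = 1)
    (hD : ∀ v : V, (d ^ o v - 1).natAbs • (v : ZMod m) = 0) {p : ℕ} (hp : p.Prime) (b : ℕ) :
    kerTorsCard (orbitWeight V (fun v => (d ^ o v - 1).natAbs) hD) (p ^ b) =
      ∏ v : V, Nat.gcd (p ^ b) ((d ^ o v - 1).natAbs / c v) := by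
  classical
  have : Fact p.Prime := ⟨hp⟩
  have hm0 : m ≠ 0 := NeZero.ne m
  have hd2 : 2 ∣ m → d % 2 = 1 := by
    intro h2
    by_contra h
    have h3 : 2 ∣ d.natAbs := by omega
    have := Nat.dvd_gcd h2 h3
    omega
  have hD0 : ∀ v : V, (d ^ o v - 1).natAbs ≠ 0 := fun v => pow_sub_one_natAbs_ne_zero hd (ho v).1
  have hcv := fun v : V => dvd_addOrderOf_and_prime_dvd hm0 hc1 hc2 hc3 hc4 hd2 v.2
  have hcD : ∀ v : V, c v ∣ (d ^ o v - 1).natAbs := fun v =>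
    (hcv v).1.trans (addOrderOf_dvd_of_nsmul_eq_zero (hD v))
  set ν := padicValNat p m with hν
  obtain ⟨m', hm⟩ : p ^ ν ∣ m := pow_padicValNat_dvd
  have hm' : Nat.Coprime m' p := by
    rw [Nat.coprime_comm, hp.coprime_iff_not_dvd]
    rintro ⟨r, rfl⟩
    have h1 : p ^ (ν + 1) ∣ m := ⟨r, by rw [pow_succ, mul_assoc]; exact hm⟩
    have := (padicValNat_dvd_iff_le hm0).1 h1
    omega
  have hjν : ∀ (v : V) (j : ℕ), addOrderOf (m' • (v : ZMod m)) = p ^ j → j ≤ ν ∧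
      p ^ j ∣ (d ^ o v - 1).natAbs := by
    intro v j hj
    constructor
    · rw [← Nat.pow_dvd_pow_iff_le_right hp.one_lt, ← hj]
      apply addOrderOf_dvd_of_nsmul_eq_zero
      rw [smul_smul, ← hm]
      simp
    · rw [← hj]
      apply addOrderOf_dvd_of_nsmul_eq_zero
      rw [smul_comm, hD, smul_zero]
  have hgcd : ∀ v : V, padicValNat p (c v) = 0 →
      Nat.gcd (p ^ b) (d ^ o v - 1).natAbs = Nat.gcd (p ^ b) ((d ^ o v - 1).natAbs / c v) := by
    intro v hv
    rw [gcd_prime_pow_eq (hD0 v), gcd_prime_pow_div_eq (hD0 v) (hcD v), hv, Nat.sub_zero]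
  suffices ∃ e ≤ ν, (∀ v : V, ∀ j, addOrderOf (m' • (v : ZMod m)) = p ^ j →
      j ≤ e + (padicValNat p (d ^ o v - 1).natAbs - b)) ∧
      (∃ x : ∀ v : V, ZMod (d ^ o v - 1).natAbs, p ^ b • x = 0 ∧
        addOrderOf (orbitWeight V _ hD x) = p ^ e) ∧
      ∏ v : V, Nat.gcd (p ^ b) (d ^ o v - 1).natAbs =
        (∏ v : V, Nat.gcd (p ^ b) ((d ^ o v - 1).natAbs / c v)) * p ^ e by
    obtain ⟨e, he, He, hx, hprod⟩ := this
    have h1 := kerTorsCard_orbitWeight_mul hm hm' hD hD0 he He hx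
    rw [hprod] at h1
    exact Nat.eq_of_mul_eq_mul_right (pow_pos hp.pos e) h1
  by_cases hpm : p ∣ m
  swap
  · have hν0 : ν = 0 := padicValNat.eq_zero_of_not_dvd hpm
    refine ⟨0, Nat.zero_le _, fun v j hj => ?_, ⟨0, by simp, by simp⟩, ?_⟩
    · have := (hjν v j hj).1
      omega
    · rw [pow_zero, mul_one]
      refine Finset.prod_congr rfl fun v _ => hgcd v (padicValNat.eq_zero_of_not_dvd fun h => ?_)
      rcases (hcv v).2 p hp h with h1 | ⟨rfl, h4, -⟩
      · exact hpm h1.1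
      · exact hpm ((by norm_num : 2 ∣ 4).trans h4)
  have hν1 : 1 ≤ ν := one_le_padicValNat_of_dvd hm0 hpm
  set w : V := ⟨((m / p ^ ν : ℕ) : ZMod m), hVstar p hp hpm ν hν1 le_rfl⟩ with hw
  have hwo : addOrderOf (w : ZMod m) = p ^ ν := addOrderOf_div_prime_pow hm0 ⟨m', hm⟩
  have hLν : ν ≤ padicValNat p (d ^ o w - 1).natAbs := by
    rw [← padicValNat_dvd_iff_le (hD0 w), ← hwo]
    exact addOrderOf_dvd_of_nsmul_eq_zero (hD w)
  have hkey : ∀ (v : V) (j : ℕ), 1 ≤ j → addOrderOf (m' • (v : ZMod m)) = p ^ j →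
      (p = 2 → 4 ∣ d ^ o v - 1 ∨ j = ν) → padicValNat p (d ^ o w - 1).natAbs ≤
        padicValNat p (d ^ o v - 1).natAbs + (ν - j) := fun v j hj1 hj h2 =>
    padicValNat_orbit_le hd hwo (ho w) (ho v).1 hj1 (hjν v j hj).1 (hjν v j hj).2 h2
  obtain ⟨xw, hxw, hxw'⟩ := exists_addOrderOf_orbitWeight hD hD0 b w hwo
  by_cases hex : p ≠ 2 ∨ d % 4 = 1 ∨ ¬ (4 ∣ m)
  · refine ⟨ν - (padicValNat p (d ^ o w - 1).natAbs - b), Nat.sub_le _ _, fun v j hj => ?_,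
      ⟨xw, hxw, hxw'⟩, ?_⟩
    · rcases Nat.eq_zero_or_pos j with rfl | hj1
      · exact Nat.zero_le _
      have h1 := (hjν v j hj).1
      have h2 := hkey v j hj1 hj fun hp2 => ?_
      · omega
      · rcases hex with h | h | h
        · exact absurd hp2 h
        · refine Or.inl (Dvd.dvd.trans (by omega) (sub_one_dvd_pow_sub_one d (o v)))
        · refine Or.inr ?_
          by_contra hne
          refine h (Dvd.dvd.trans ?_ (Dvd.intro _ hm.symm))
          rw [hp2]
          exact (by norm_num : 4 ∣ 2 ^ 2).trans (pow_dvd_pow 2 (by omega))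
    · have hval : padicValNat p (c w) = ν := by
        rw [hc1 p hp hpm hex, padicValNat.prime_pow]
      have h1 : ∀ v : V, Nat.gcd (p ^ b) (d ^ o v - 1).natAbs =
          Nat.gcd (p ^ b) ((d ^ o v - 1).natAbs / c v) *
            if v = w then p ^ (ν - (padicValNat p (d ^ o w - 1).natAbs - b)) else 1 := by
        intro v
        split_ifs with hvw
        · rw [hvw, gcd_prime_pow_eq (hD0 w), gcd_prime_pow_div_eq (hD0 w) (hcD w), hval, ← pow_add]
          congr 1
          omega
        · rw [mul_one]
          refine hgcd v (padicValNat.eq_zero_of_not_dvd fun h => ?_)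
          rcases (hcv v).2 p hp h with h1 | ⟨h2, h4, hd4, -⟩
          · exact hvw (Subtype.ext h1.2)
          · omega
      rw [Finset.prod_congr rfl fun v _ => h1 v, Finset.prod_mul_distrib, Finset.prod_ite_eq' ]
      simp
  · push Not at hex
    obtain ⟨hp2, hd41, h4⟩ := hex
    have hd4 : d % 4 = 3 := by
      have := hd2 (hp2 ▸ hpm)
      omega
    have hν2 : 2 ≤ ν := by
      rw [← padicValNat_dvd_iff_le hm0, hp2]
      exact h4
    have hu0 : ((m / 2 : ℕ) : ZMod m) ∈ V := by
      have := hVstar p hp hpm 1 le_rfl hν1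
      rwa [hp2, pow_one] at this
    set u : V := ⟨((m / 2 : ℕ) : ZMod m), hu0⟩ with hu
    have huo : addOrderOf (u : ZMod m) = p ^ 1 := by
      have := addOrderOf_div_prime_pow (p := 2) (j := 1) hm0 (by simpa using hp2 ▸ hpm)
      rw [pow_one] at this
      rw [hp2, pow_one]
      exact this
    have huw : u ≠ w := by
      intro h
      rw [h, hwo] at huo
      have := Nat.pow_right_injective hp.two_le huo
      omega
    have hou : o u = 1 := by
      refine le_antisymm ((ho u).2.2 1 one_pos ?_) (ho u).1
      rw [pow_mul_eq_self_iff, huo, hp2, pow_one, pow_one]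
      omega
    have hLu : padicValNat p (d ^ o u - 1).natAbs = 1 := by
      have h1 := hD0 u
      rw [hou, pow_one] at h1 ⊢
      apply le_antisymm
      · by_contra hlt
        have h2 := (padicValNat_dvd_iff_le (p := p) (n := 2) h1).2 (by omega)
        rw [hp2] at h2
        omega
      · rw [← padicValNat_dvd_iff_le h1, hp2]
        omega
    obtain ⟨xu, hxu, hxu'⟩ := exists_addOrderOf_orbitWeight hD hD0 b u huo
    rw [hLu] at hxu'
    refine ⟨max (1 - (1 - b)) (ν - (padicValNat p (d ^ o w - 1).natAbs - b)), by omega,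
      fun v j hj => ?_, ?_, ?_⟩
    · rcases Nat.eq_zero_or_pos j with rfl | hj1
      · exact Nat.zero_le _
      have h1 := (hjν v j hj).1
      have hjL := (padicValNat_dvd_iff_le (hD0 v)).1 (hjν v j hj).2
      rcases Nat.lt_or_ge 1 (padicValNat p (d ^ o v - 1).natAbs) with hL | hL
      · have h2 := hkey v j hj1 hj fun _ => Or.inl ?_
        · omega
        · have h3 := (padicValNat_dvd_iff_le (p := p) (n := 2) (hD0 v)).2 hL
          rw [hp2] at h3
          omega
      · omega
    · rcases le_total (1 - (1 - b)) (ν - (padicValNat p (d ^ o w - 1).natAbs - b)) with h | h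
      · rw [max_eq_right h]
        exact ⟨xw, hxw, hxw'⟩
      · rw [max_eq_left h]
        exact ⟨xu, hxu, hxu'⟩
    · have hvalw : padicValNat p (c w) = ν - 1 := by
        have h1 := hc2 h4 hd4
        rw [← hp2] at h1
        rw [hw, h1, ← hν]
        conv_lhs => rw [show p ^ ν / p = p ^ (ν - 1) from by
          rw [Nat.div_eq_iff_eq_mul_left hp.pos (dvd_pow_self p (by omega)), ← pow_succ,
            Nat.sub_add_cancel hν1]]
        rw [padicValNat.prime_pow]
      have hvalu : padicValNat p (c u) = 1 := by
        rw [hu, hc3 h4 hd4, ← hp2, padicValNat_self]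
      have h1 : ∀ v : V, Nat.gcd (p ^ b) (d ^ o v - 1).natAbs =
          Nat.gcd (p ^ b) ((d ^ o v - 1).natAbs / c v) *
            ((if v = w then p ^ (min b (padicValNat p (d ^ o w - 1).natAbs) -
              min b (padicValNat p (d ^ o w - 1).natAbs - (ν - 1))) else 1) *
            (if v = u then p ^ min b 1 else 1)) := by
        intro v
        by_cases hvw : v = w
        · rw [if_pos hvw, if_neg (hvw ▸ huw.symm), mul_one, hvw, gcd_prime_pow_eq (hD0 w),
            gcd_prime_pow_div_eq (hD0 w) (hcD w), hvalw, ← pow_add]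
          congr 1
          omega
        · rw [if_neg hvw, one_mul]
          split_ifs with hvu
          · rw [hvu, gcd_prime_pow_eq (hD0 u), gcd_prime_pow_div_eq (hD0 u) (hcD u), hvalu, hLu,
              ← pow_add]
            congr 1
            omega
          · rw [mul_one]
            refine hgcd v (padicValNat.eq_zero_of_not_dvd fun h => ?_)
            rcases (hcv v).2 p hp h with h1 | ⟨h2, h4, hd4, h5⟩
            · exact hvw (Subtype.ext h1.2)
            · exact hvu (Subtype.ext h5)
      rw [Finset.prod_congr rfl fun v _ => h1 v, Finset.prod_mul_distrib, Finset.prod_mul_distrib,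
        Finset.prod_ite_eq', Finset.prod_ite_eq', if_pos (mem_univ _), if_pos (mem_univ _),
        ← pow_add]
      congr 2
      omega

theorem kerTorsCard_dune_eq_orbitWeight {n m : ℕ} [NeZero n] (hmn : m ∣ n) {d : ℤ}
    (hcop : Nat.gcd m d.natAbs = 1) {K : ℕ} (hK : n ∣ d.natAbs ^ K * m)
    {V : Finset (ZMod m)} (h0 : (0 : ZMod m) ∉ V)
    (hcover : ∀ w : ZMod m, w ≠ 0 → ∃ v ∈ V, ∃ i : ℕ, (d : ZMod m) ^ i * v = w)
    (hsep : ∀ v ∈ V, ∀ v' ∈ V, (∃ i : ℕ, (d : ZMod m) ^ i * v = v') → v = v')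
    (o : ZMod m → ℕ)
    (ho : ∀ w : ZMod m, 0 < o w ∧ (d : ZMod m) ^ (o w) * w = w ∧
      ∀ e : ℕ, 0 < e → (d : ZMod m) ^ e * w = w → o w ≤ e)
    (hD : ∀ v : V, (d ^ o v - 1).natAbs • (v : ZMod m) = 0) {q : ℕ}
    (hq : Nat.Coprime d.natAbs q) :
    kerTorsCard (duneWeight n d).toAddMonoidHom q =
      kerTorsCard (orbitWeight V (fun v => (d ^ o v - 1).natAbs) hD) q := by
  obtain ⟨ψ, hsurj, hker, hψ⟩ := exists_orbit_hom hmn hcop hK h0 hcover hsep o ho hD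
  refine kerTorsCard_congr (f := ψ) (hq.pow_left K) hker hsurj fun x hx => ?_
  rw [hψ]
  constructor
  · intro h
    rw [show duneWeight n d x = 0 from h, map_zero]
  · intro h
    have h1 := pow_mul_eq_zero_of_castHom hmn hK h
    refine nsmul_eq_zero_of_coprime (hq.pow_left K) ?_
      (show q • duneWeight n d x = 0 by rw [← map_nsmul, hx, map_zero])
    rw [← Int.natAbs_pow, natAbs_smul_eq_zero_iff, zsmul_eq_mul]
    push_cast
    exact h1

theorem pushMul_mul (n : ℕ) (a b : ℤ) (y : ZMod n →₀ ℤ) :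
    pushMul n (a * b) y = pushMul n a (pushMul n b y) := by
  have : pushMul n (a * b) = pushMul n a ∘ₗ pushMul n b := by
    ext v : 2
    simp [pushMul_single, mul_assoc]
  rw [this]
  rfl

theorem duneMap_injective {n : ℕ} [NeZero n] {d : ℤ} (hd : 2 ≤ |d|) :
    Function.Injective (duneMap n d) := by
  rw [injective_iff_map_eq_zero]
  intro y hy
  have h1 : pushMul n d y = d • y := by
    rw [duneMap_apply, sub_eq_zero] at hy
    exact hy.symm
  have h2 : ∀ j : ℕ, pushMul n (d ^ j) y = d ^ j • y := by
    intro j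
    induction j with
    | zero =>
      rw [pow_zero, one_smul, pushMul]
      simp [Finsupp.lmapDomain_apply, Finsupp.mapDomain]
    | succ j ih => rw [pow_succ, pushMul_mul, h1, map_smul, ih, smul_smul, mul_comm]
  obtain ⟨i, j, hij, h⟩ := Finite.exists_ne_map_eq_of_infinite fun j : ℕ => (d : ZMod n) ^ j
  have h3 : pushMul n (d ^ i) = pushMul n (d ^ j) := by
    rw [pushMul, pushMul]
    push_cast
    rw [show (d : ZMod n) ^ i = (d : ZMod n) ^ j from h]
  have h4 : (d ^ i - d ^ j) • y = 0 := by rw [sub_smul, ← h2, ← h2, h3, sub_self]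
  refine (smul_eq_zero.1 h4).resolve_left fun h5 => hij ?_
  exact Int.pow_right_injective (a := d) (by rw [Int.abs_eq_natAbs] at hd; omega) (sub_eq_zero.1 h5)

theorem exists_mapDomain_of_smul_eq {α β : Type*} {f : α → β} (hf : Function.Injective f) {c : ℤ}
    (hc : c ≠ 0) {z : β →₀ ℤ} {y : α →₀ ℤ} (h : c • z = Finsupp.mapDomain f y) :
    ∃ w, Finsupp.mapDomain f w = z := by
  refine ⟨z.comapDomain f hf.injOn, Finsupp.mapDomain_comapDomain f hf z fun v hv => ?_⟩
  by_contra hv'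
  have h1 := Finsupp.mapDomain_of_notMem_range y v hv'
  rw [← h, Finsupp.smul_apply, smul_eq_mul] at h1
  exact Finsupp.mem_support_iff.1 hv ((mul_eq_zero.1 h1).resolve_left hc)

/-- The group generated by `ℤ/n` with relations `d·[v] = [d·v]`. -/
abbrev FullDune (n : ℕ) (d : ℤ) := (ZMod n →₀ ℤ) ⧸ LinearMap.range (duneMap n d)

/-- The homomorphism `[v] ↦ v` from the full sand dune group to `ℤ/n`. -/
def fullWeight (n : ℕ) (d : ℤ) : FullDune n d →ₗ[ℤ] ZMod n :=
  (LinearMap.range (duneMap n d)).liftQ (weight n) (by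
    rintro _ ⟨y, rfl⟩
    exact weight_duneMap n d y)

theorem kerTorsCard_dune_eq_full (n : ℕ) (d : ℤ) {q : ℕ} (hq : Nat.Coprime (d - 1).natAbs q) :
    kerTorsCard (duneWeight n d).toAddMonoidHom q =
      kerTorsCard (fullWeight n d).toAddMonoidHom q := by
  have hle : LinearMap.range (duneMap n d) ≤ duneRel n d := le_sup_left
  refine (kerTorsCard_congr (f := (Submodule.factor hle).toAddMonoidHom) hq ?_
    (Submodule.factor_surjective hle) ?_).symm
  · intro x hx
    obtain ⟨y, rfl⟩ := Submodule.mkQ_surjective _ x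
    have h1 : y ∈ duneRel n d := (Submodule.Quotient.mk_eq_zero _).1 hx
    obtain ⟨_, ⟨z, rfl⟩, w, hw, rfl⟩ := Submodule.mem_sup.1 h1
    obtain ⟨a, rfl⟩ := Submodule.mem_span_singleton.1 hw
    rw [natAbs_smul_eq_zero_iff, ← map_smul, Submodule.mkQ_apply, Submodule.Quotient.mk_eq_zero,
      smul_add]
    refine Submodule.add_mem _ (Submodule.smul_mem _ _ ⟨z, rfl⟩) ?_
    rw [smul_comm]
    refine Submodule.smul_mem _ _ ⟨Finsupp.single 0 1, ?_⟩
    rw [duneMap_single, mul_zero, sub_smul, one_smul]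
  · intro x _
    obtain ⟨y, rfl⟩ := Submodule.mkQ_surjective _ x
    exact Iff.rfl

theorem kerTorsCard_mul_of_comp_eq_smul {M N B C : Type*} [AddCommGroup M] [AddCommGroup N]
    [AddCommGroup B] [AddCommGroup C] {π : M →+ N} {ι : N →+ M} (hι : Function.Injective ι)
    {wM : M →+ B} {wN : N →+ C} {q s e : ℕ} (hιπ : ∀ x, ι (π x) = 0 ↔ (q * e) • x = 0)
    (he : Nat.Coprime e (q * s)) (hw : ∀ x, wM x = 0 → wN (π x) = 0)
    (hsurj : ∀ y, wN y = 0 → ∃ x, wM x = 0 ∧ π x = y) :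
    kerTorsCard wM (q * s) = kerTorsCard wM q * kerTorsCard wN s := by
  have hπ : ∀ x, π x = 0 ↔ (q * e) • x = 0 := fun x => by
    rw [← hιπ, map_eq_zero_iff ι hι]
  let G : AddSubgroup M := (nsmulAddMonoidHom (α := M) (q * s)).ker ⊓ wM.ker
  let H : AddSubgroup N := (nsmulAddMonoidHom (α := N) s).ker ⊓ wN.ker
  have hmem : ∀ x : G, π x ∈ H := by
    rintro ⟨x, hx, hx'⟩
    refine ⟨?_, hw x hx'⟩
    change s • π x = 0
    rw [← map_nsmul, hπ, smul_smul, mul_right_comm, mul_comm, mul_smul,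
      show (q * s) • x = 0 from hx, smul_zero]
  let f : G →+ H := (π.comp G.subtype).codRestrict H hmem
  have hf : Function.Surjective f := by
    rintro ⟨y, hy, hy'⟩
    obtain ⟨x, hx, rfl⟩ := hsurj y hy'
    obtain ⟨a, ha⟩ := exists_nsmul_eq_self (he.coprime_dvd_right (Dvd.intro_left q rfl))
    have h1 : (q * e) • s • x = 0 := by
      rw [← hπ, map_nsmul]
      exact hy
    refine ⟨⟨(a * e) • x, ?_, ?_⟩, Subtype.ext ?_⟩
    · change (q * s) • (a * e) • x = 0
      rw [smul_smul, show q * s * (a * e) = a * (q * e * s) by ring, mul_smul, mul_smul, h1,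
        smul_zero]
    · change wM ((a * e) • x) = 0
      rw [map_nsmul, hx, smul_zero]
    · change π ((a * e) • x) = π x
      rw [map_nsmul]
      exact ha (π x) hy
  have h2 := AddSubgroup.card_eq_card_quotient_mul_card_addSubgroup f.ker
  rw [Nat.card_congr (QuotientAddGroup.quotientKerEquivOfSurjective f hf).toEquiv, mul_comm] at h2
  refine h2.trans (congrArg₂ _ (Nat.card_congr (Equiv.ofBijective
    (fun x => ⟨x.1.1, ?_, x.1.2.2⟩) ⟨?_, ?_⟩)) rfl)
  · have h3 : π x.1.1 = 0 := congrArg Subtype.val x.2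
    rw [hπ, mul_comm, mul_smul] at h3
    have h4 : (q * s) • x.1.1 = 0 := x.1.2.1
    refine nsmul_eq_zero_of_coprime (he.coprime_dvd_right (dvd_refl (q * s))) h3 ?_
    rw [smul_comm, h4, smul_zero]
  · exact fun x y hxy => Subtype.ext (Subtype.ext (Subtype.mk.inj hxy))
  · rintro ⟨x, hx, hx'⟩
    refine ⟨⟨⟨x, ?_, hx'⟩, Subtype.ext ?_⟩, rfl⟩
    · change (q * s) • x = 0
      rw [mul_comm, mul_smul, hx, smul_zero]
    · change π x = 0
      rw [hπ, mul_comm, mul_smul, hx, smul_zero]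

theorem exists_dilation {n n' g : ℕ} [NeZero n] (hn : n = n' * g) {d : ℤ}
    (hg : g = Nat.gcd n d.natAbs) :
    ∃ δ : ZMod n' →+ ZMod n, Function.Injective δ ∧ ∀ a : ℤ, δ a = (d : ZMod n) * a := by
  obtain ⟨d', hd'⟩ : g ∣ d.natAbs := hg ▸ Nat.gcd_dvd_right _ _
  have hd'' : (g : ℤ) ∣ d := Int.natCast_dvd.2 ⟨d', hd'⟩
  have h1 : (zmultiplesHom (ZMod n) (d : ZMod n)) n' = 0 := by
    rw [zmultiplesHom_apply, natCast_zsmul, nsmul_eq_mul]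
    have : (((n' * d : ℤ)) : ZMod n) = 0 := by
      rw [ZMod.intCast_zmod_eq_zero_iff_dvd, hn]
      push_cast
      exact mul_dvd_mul_left _ hd''
    simpa using this
  have hδ : ∀ a : ℤ, ZMod.lift n' ⟨zmultiplesHom (ZMod n) (d : ZMod n), h1⟩ (a : ZMod n') =
      (d : ZMod n) * a := fun a => by simp [mul_comm]
  refine ⟨ZMod.lift n' ⟨zmultiplesHom (ZMod n) (d : ZMod n), h1⟩, ?_, hδ⟩
  rw [injective_iff_map_eq_zero]
  intro x hx
  obtain ⟨a, rfl⟩ := ZMod.intCast_surjective x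
  rw [hδ] at hx
  have hg0 : 0 < g := Nat.pos_of_ne_zero fun h => NeZero.ne n (by rw [hn, h, mul_zero])
  have h2 : (n : ℤ) ∣ d * a := by
    rw [← ZMod.intCast_zmod_eq_zero_iff_dvd]
    simpa using hx
  rw [ZMod.intCast_zmod_eq_zero_iff_dvd, Int.natCast_dvd]
  rw [Int.natCast_dvd, Int.natAbs_mul, hd', hn, mul_comm n', mul_assoc] at h2
  have h3 := Nat.dvd_of_mul_dvd_mul_left hg0 h2
  refine Nat.Coprime.dvd_of_dvd_mul_left ?_ h3
  have h4 : g * Nat.gcd n' d' = g * 1 := by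
    rw [← Nat.gcd_mul_left, ← hd', mul_comm g, ← hn, ← hg, mul_one]
  exact Nat.eq_of_mul_eq_mul_left hg0 h4

/-- The map of free groups induced by the reduction of residues to a divisor of `n`. -/
def redMap {n n' : ℕ} (h : n' ∣ n) : (ZMod n →₀ ℤ) →ₗ[ℤ] (ZMod n' →₀ ℤ) :=
  Finsupp.lmapDomain ℤ ℤ (ZMod.castHom h (ZMod n'))

theorem redMap_single {n n' : ℕ} (h : n' ∣ n) (v : ZMod n) (a : ℤ) :
    redMap h (Finsupp.single v a) = Finsupp.single (ZMod.castHom h (ZMod n') v) a :=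
  Finsupp.mapDomain_single

theorem redMap_surjective {n n' : ℕ} (h : n' ∣ n) : Function.Surjective (redMap h) :=
  Finsupp.mapDomain_surjective (ZMod.castHom_surjective h)

theorem weight_redMap {n n' : ℕ} (h : n' ∣ n) (y : ZMod n →₀ ℤ) :
    weight n' (redMap h y) = ZMod.castHom h (ZMod n') (weight n y) := by
  induction y using Finsupp.induction_linear with
  | zero => simp
  | add x y hx hy => simp only [map_add, hx, hy]
  | single v a => rw [redMap_single, weight_single, weight_single, map_zsmul]

theorem redMap_duneMap {n n' : ℕ} (h : n' ∣ n) (d : ℤ) (y : ZMod n →₀ ℤ) :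
    redMap h (duneMap n d y) = duneMap n' d (redMap h y) := by
  rw [duneMap_apply, duneMap_apply, map_sub, map_smul]
  congr 1
  induction y using Finsupp.induction_linear with
  | zero => simp
  | add x y hx hy => simp only [map_add, hx, hy]
  | single v a => rw [redMap_single, pushMul_single, pushMul_single, redMap_single, map_mul,
      map_intCast]

section

variable {n n' : ℕ} (h : n' ∣ n) {d : ℤ} {δ : ZMod n' →+ ZMod n}
  (hδ : ∀ a : ℤ, δ a = (d : ZMod n) * a)

include hδ

theorem mapDomain_redMap (y : ZMod n →₀ ℤ) :
    Finsupp.mapDomain δ (redMap h y) = pushMul n d y := by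
  induction y using Finsupp.induction_linear with
  | zero => simp
  | add x y hx hy => rw [map_add, map_add, ← hx, ← hy, Finsupp.mapDomain_add]
  | single v a =>
    obtain ⟨b, rfl⟩ := ZMod.intCast_surjective v
    rw [redMap_single, pushMul_single, Finsupp.mapDomain_single, map_intCast, hδ]

theorem duneMap_mapDomain (y : ZMod n' →₀ ℤ) :
    duneMap n d (Finsupp.mapDomain δ y) = Finsupp.mapDomain δ (duneMap n' d y) := by
  change _ = Finsupp.lmapDomain ℤ ℤ δ _
  rw [duneMap_apply, duneMap_apply, map_sub, map_smul, Finsupp.lmapDomain_apply,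
    Finsupp.lmapDomain_apply]
  congr 1
  induction y using Finsupp.induction_linear with
  | zero => simp
  | add x y hx hy => rw [Finsupp.mapDomain_add, map_add, hx, hy, map_add, Finsupp.mapDomain_add]
  | single v a =>
    obtain ⟨b, rfl⟩ := ZMod.intCast_surjective v
    have h1 := hδ (d * b)
    rw [Int.cast_mul, Int.cast_mul] at h1
    rw [pushMul_single, Finsupp.mapDomain_single, Finsupp.mapDomain_single, pushMul_single, hδ, h1]

include h

theorem exists_duneMap_eq (hinj : Function.Injective δ) (hd0 : d ≠ 0) {y : ZMod n' →₀ ℤ}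
    {z : ZMod n →₀ ℤ} (hz : Finsupp.mapDomain δ y = duneMap n d z) :
    ∃ w, Finsupp.mapDomain δ w = z ∧ y = duneMap n' d w := by
  have h1 : d • z = Finsupp.mapDomain δ (y + redMap h z) := by
    rw [Finsupp.mapDomain_add, hz, mapDomain_redMap h hδ, duneMap_apply, sub_add_cancel]
  obtain ⟨w, rfl⟩ := exists_mapDomain_of_smul_eq hinj hd0 h1
  refine ⟨w, rfl, Finsupp.mapDomain_injective hinj ?_⟩
  rw [hz, duneMap_mapDomain hδ]

/-- Reduction and dilation pass to the full sand dune groups and compose to multiplication. -/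
theorem exists_fullDune_homs [NeZero n] (hinj : Function.Injective δ) (hd0 : d ≠ 0) :
    ∃ (π : FullDune n d →+ FullDune n' d) (ι : FullDune n' d →+ FullDune n d),
      Function.Injective ι ∧ (∀ x, ι (π x) = d • x) ∧
      (∀ x, fullWeight n d x = 0 → fullWeight n' d (π x) = 0) ∧
      ∀ y, fullWeight n' d y = 0 → ∃ x, fullWeight n d x = 0 ∧ π x = y := by
  refine ⟨((LinearMap.range (duneMap n d)).mapQ (LinearMap.range (duneMap n' d)) (redMap h) ?_
    ).toAddMonoidHom, ((LinearMap.range (duneMap n' d)).mapQ (LinearMap.range (duneMap n d))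
      (Finsupp.lmapDomain ℤ ℤ δ) ?_).toAddMonoidHom, ?_, ?_, ?_, ?_⟩
  · rintro _ ⟨y, rfl⟩
    exact ⟨redMap h y, (redMap_duneMap h d y).symm⟩
  · rintro _ ⟨y, rfl⟩
    exact ⟨Finsupp.mapDomain δ y, duneMap_mapDomain hδ y⟩
  · rw [injective_iff_map_eq_zero]
    intro x hx
    obtain ⟨y, rfl⟩ := Submodule.mkQ_surjective _ x
    obtain ⟨z, hz⟩ := (Submodule.Quotient.mk_eq_zero _).1 hx
    obtain ⟨w, -, rfl⟩ := exists_duneMap_eq h hδ hinj hd0 hz.symm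
    exact (Submodule.Quotient.mk_eq_zero _).2 ⟨w, rfl⟩
  · intro x
    obtain ⟨y, rfl⟩ := Submodule.mkQ_surjective _ x
    refine (Submodule.Quotient.eq _).2 ⟨-y, ?_⟩
    change _ = Finsupp.mapDomain δ (redMap h y) - d • y
    rw [mapDomain_redMap h hδ, map_neg, duneMap_apply, neg_sub]
  · intro x hx
    obtain ⟨y, rfl⟩ := Submodule.mkQ_surjective _ x
    change weight n y = 0 at hx
    change weight n' (redMap h y) = 0
    rw [weight_redMap, hx, map_zero]
  · intro y hy
    obtain ⟨y, rfl⟩ := Submodule.mkQ_surjective _ y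
    obtain ⟨z, rfl⟩ := redMap_surjective h y
    change weight n' (redMap h z) = 0 at hy
    rw [weight_redMap] at hy
    obtain ⟨a, ha⟩ := ZMod.intCast_surjective (weight n z)
    rw [← ha, map_intCast, ZMod.intCast_zmod_eq_zero_iff_dvd] at hy
    obtain ⟨b, rfl⟩ := hy
    refine ⟨(LinearMap.range (duneMap n d)).mkQ
      (z - b • (Finsupp.single (n' : ZMod n) 1 - Finsupp.single 0 1)), ?_, ?_⟩
    · change weight n _ = 0
      rw [map_sub, ← ha, map_smul, map_sub, weight_single, weight_single]
      simp [mul_comm]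
    · have h1 : redMap h (z - b • (Finsupp.single (n' : ZMod n) 1 - Finsupp.single 0 1)) =
          redMap h z := by
        rw [map_sub, map_smul, map_sub, redMap_single, redMap_single]
        simp
      exact congrArg (LinearMap.range (duneMap n' d)).mkQ h1

theorem nsmul_eq_zero_iff_fullDune (hinj : Function.Injective δ) {t : ℕ} (ht : t ≠ 0) {t' : ℤ}
    (hd : d = t * t') (x : FullDune n d) :
    t • x = 0 ↔ ∃ z, redMap h z = 0 ∧ (LinearMap.range (duneMap n d)).mkQ (t' • z) = x := by
  constructor
  · intro hx
    obtain ⟨y, rfl⟩ := Submodule.mkQ_surjective _ x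
    obtain ⟨z, hz⟩ := (Submodule.Quotient.mk_eq_zero _).1 hx
    change _ = t • y at hz
    have h1 : (t : ℤ) • (t' • z - y) = Finsupp.mapDomain δ (redMap h z) := by
      rw [mapDomain_redMap h hδ, smul_sub, smul_smul, ← hd, natCast_zsmul, ← hz, duneMap_apply,
        sub_sub_cancel]
    obtain ⟨w, hw⟩ := exists_mapDomain_of_smul_eq hinj (by exact_mod_cast ht) h1
    obtain ⟨v, rfl⟩ := redMap_surjective h w
    rw [mapDomain_redMap h hδ] at hw
    have h2 : redMap h z = (t : ℤ) • redMap h v := by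
      apply Finsupp.mapDomain_injective hinj
      rw [← h1, ← hw, ← mapDomain_redMap h hδ]
      exact (map_smul (Finsupp.lmapDomain ℤ ℤ δ) _ _).symm
    refine ⟨z - (t : ℤ) • v, by rw [map_sub, map_smul, h2, sub_self], ?_⟩
    refine (Submodule.Quotient.eq _).2 ⟨-v, ?_⟩
    rw [map_neg, duneMap_apply, hw, smul_sub, smul_smul, mul_comm t', ← hd]
    abel
  · rintro ⟨z, hz, rfl⟩
    refine (Submodule.Quotient.mk_eq_zero _).2 ⟨z, ?_⟩
    rw [duneMap_apply, ← mapDomain_redMap h hδ, hz, Finsupp.mapDomain_zero, sub_zero, hd,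
      mul_smul, natCast_zsmul]

theorem mkQ_smul_eq_zero_iff [NeZero n] (hd2 : 2 ≤ |d|) {t : ℕ} (ht : t ≠ 0) {t' : ℤ}
    (hd : d = t * t') {z : ZMod n →₀ ℤ} (hz : redMap h z = 0) :
    (LinearMap.range (duneMap n d)).mkQ (t' • z) = 0 ↔ ∃ w, redMap h w = 0 ∧ z = (t : ℤ) • w := by
  have h1 : ∀ w, redMap h w = 0 → duneMap n d w = d • w := fun w hw => by
    rw [duneMap_apply, ← mapDomain_redMap h hδ, hw, Finsupp.mapDomain_zero, sub_zero]
  constructor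
  · intro h0
    obtain ⟨w, hw⟩ := (Submodule.Quotient.mk_eq_zero _).1 h0
    have h2 : z = (t : ℤ) • w := by
      apply duneMap_injective hd2
      rw [map_smul, hw, h1 z hz, smul_smul, hd]
    refine ⟨w, ?_, h2⟩
    rw [h2, map_smul] at hz
    exact (smul_eq_zero.1 hz).resolve_left (by exact_mod_cast ht)
  · rintro ⟨w, hw, rfl⟩
    refine (Submodule.Quotient.mk_eq_zero _).2 ⟨w, ?_⟩
    rw [h1 w hw, smul_smul, mul_comm, ← hd]

end

theorem finrank_ker_redMap {n n' : ℕ} [NeZero n] (h : n' ∣ n) :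
    Module.finrank ℤ (LinearMap.ker (redMap h)) = n - n' := by
  have : NeZero n' := ⟨fun h0 => NeZero.ne n (by simpa [h0] using h)⟩
  have h1 := LinearMap.rank_eq_of_surjective (redMap_surjective h)
  rw [← Module.finrank_eq_rank, ← Module.finrank_eq_rank, ← Module.finrank_eq_rank,
    Module.finrank_finsupp_self, Module.finrank_finsupp_self, ZMod.card, ZMod.card] at h1
  norm_cast at h1
  omega

theorem torsCard_fullDune {n n' : ℕ} [NeZero n] (h : n' ∣ n) {d : ℤ} (hd2 : 2 ≤ |d|)
    {δ : ZMod n' →+ ZMod n} (hδ : ∀ a : ℤ, δ a = (d : ZMod n) * a)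
    (hinj : Function.Injective δ) {t : ℕ} (ht : t ≠ 0) {t' : ℤ} (hd : d = t * t') :
    torsCard (FullDune n d) t = t ^ (n - n') := by
  have : NeZero t := ⟨ht⟩
  let Z := LinearMap.ker (redMap h)
  let b := Module.finBasis ℤ Z
  let f : Z →ₗ[ℤ] FullDune n d := (LinearMap.range (duneMap n d)).mkQ ∘ₗ (t' • Z.subtype)
  let r : Z →+ (Fin (Module.finrank ℤ Z) → ZMod t) :=
    (AddMonoidHom.compLeft (Int.castAddHom (ZMod t)) _).comp b.equivFun.toLinearMap.toAddMonoidHom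
  have hr : Function.Surjective r := by
    intro y
    choose a ha using fun i => ZMod.intCast_surjective (y i)
    refine ⟨b.equivFun.symm a, funext fun i => ?_⟩
    change ((b.equivFun (b.equivFun.symm a) i : ℤ) : ZMod t) = y i
    rw [LinearEquiv.apply_symm_apply, ha]
  have hker : f.toAddMonoidHom.ker = r.ker := by
    ext z
    rw [AddMonoidHom.mem_ker, AddMonoidHom.mem_ker]
    refine (mkQ_smul_eq_zero_iff h hδ hd2 ht hd (LinearMap.mem_ker.1 z.2)).trans ?_
    constructor
    · rintro ⟨w, hw, hzw⟩
      have h1 : z = (t : ℤ) • (⟨w, hw⟩ : Z) := Subtype.ext hzw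
      rw [h1, map_zsmul]
      funext i
      simp
    · intro hz
      have h1 : ∀ i, (t : ℤ) ∣ b.equivFun z i := fun i =>
        (ZMod.intCast_zmod_eq_zero_iff_dvd _ _).1 (congrFun hz i)
      choose a ha using h1
      refine ⟨b.equivFun.symm a, LinearMap.mem_ker.1 (b.equivFun.symm a).2, ?_⟩
      have h2 : z = (t : ℤ) • b.equivFun.symm a := by
        apply b.equivFun.injective
        rw [map_smul, LinearEquiv.apply_symm_apply]
        funext i
        exact ha i
      exact congrArg Subtype.val h2
  have hrange : torsCard (FullDune n d) t = Nat.card f.toAddMonoidHom.range := by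
    refine Nat.card_congr (Equiv.subtypeEquivRight fun x => ?_)
    rw [nsmul_eq_zero_iff_fullDune h hδ hinj ht hd]
    constructor
    · rintro ⟨z, hz, rfl⟩
      exact ⟨⟨z, hz⟩, rfl⟩
    · rintro ⟨z, rfl⟩
      exact ⟨z, z.2, rfl⟩
  rw [hrange, ← Nat.card_congr (QuotientAddGroup.quotientKerEquivRange f.toAddMonoidHom).toEquiv,
    hker, Nat.card_congr (QuotientAddGroup.quotientKerEquivOfSurjective r hr).toEquiv,
    Nat.card_fun, Nat.card_zmod, Nat.card_fin, finrank_ker_redMap h]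

theorem kerTorsCard_full_mul {n n' g : ℕ} [NeZero n] (hn : n = n' * g) {d : ℤ} (hd2 : 2 ≤ |d|)
    (hg : g = Nat.gcd n d.natAbs) {p a b e : ℕ} [hp : Fact p.Prime] (hd : d.natAbs = p ^ a * e)
    (he : Nat.Coprime e p) (hb : b ≤ a) :
    kerTorsCard (fullWeight n d).toAddMonoidHom (p ^ b) * p ^ (padicValNat p g - (a - b)) =
      p ^ (b * (n - n')) := by
  have h : n' ∣ n := ⟨g, hn⟩
  have hn0 : n ≠ 0 := NeZero.ne n
  have hn'0 : n' ≠ 0 := fun h => hn0 (by rw [hn, h, zero_mul])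
  have hg0 : g ≠ 0 := fun h => hn0 (by rw [hn, h, mul_zero])
  have hpb : p ^ b ≠ 0 := pow_ne_zero _ hp.out.ne_zero
  obtain ⟨δ, hinj, hδ⟩ := exists_dilation hn hg
  obtain ⟨t', ht'⟩ : ((p ^ b : ℕ) : ℤ) ∣ d :=
    Int.natCast_dvd.2 (hd ▸ dvd_mul_of_dvd_left (pow_dvd_pow p hb) e)
  have htn : t'.natAbs = p ^ (a - b) * e := by
    apply Nat.eq_of_mul_eq_mul_left (Nat.pos_of_ne_zero hpb)
    rw [← mul_assoc, ← pow_add, Nat.add_sub_cancel' hb, ← hd]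
    conv_rhs => rw [ht', Int.natAbs_mul, Int.natAbs_natCast]
  have hgd : ∀ j, g ∣ p ^ j * t'.natAbs ↔ padicValNat p g ≤ j + (a - b) := by
    intro j
    obtain ⟨g', hg'⟩ : p ^ padicValNat p g ∣ g := pow_padicValNat_dvd
    have h1 : Nat.Coprime g' (p ^ a) := by
      refine Nat.Coprime.pow_right _ ?_
      rw [Nat.coprime_comm, hp.out.coprime_iff_not_dvd]
      rintro ⟨r, rfl⟩
      have h1 : p ^ (padicValNat p g + 1) ∣ g := ⟨r, by rw [pow_succ, mul_assoc]; exact hg'⟩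
      have := (padicValNat_dvd_iff_le hg0).1 h1
      omega
    rw [htn, ← mul_assoc, ← pow_add]
    constructor
    · intro h2
      have h3 := (pow_padicValNat_dvd (p := p)).trans h2
      exact (Nat.pow_dvd_pow_iff_le_right hp.out.one_lt).1
        ((he.symm.pow_left _).dvd_of_dvd_mul_right h3)
    · intro h2
      have h3 : g' ∣ e := by
        refine h1.dvd_of_dvd_mul_left ?_
        rw [← hd]
        exact (Dvd.intro_left _ hg'.symm).trans (hg ▸ Nat.gcd_dvd_right _ _)
      rw [hg', ← hg']
      conv_lhs => rw [hg']
      exact mul_dvd_mul (pow_dvd_pow p h2) h3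
  have hzero : ∀ (j : ℕ), p ^ j • t' • ((n' : ℤ) : ZMod n) = 0 ↔
      padicValNat p g ≤ j + (a - b) := by
    intro j
    rw [← hgd]
    have h1 : p ^ j • t' • ((n' : ℤ) : ZMod n) = (((p : ℤ) ^ j * t' * n' : ℤ) : ZMod n) := by
      simp [mul_assoc]
    rw [h1, ZMod.intCast_zmod_eq_zero_iff_dvd, Int.natCast_dvd, Int.natAbs_mul, Int.natAbs_mul,
      Int.natAbs_pow, Int.natAbs_natCast, Int.natAbs_natCast]
    conv_lhs => rw [hn, mul_comm n']
    exact Nat.mul_dvd_mul_iff_right (Nat.pos_of_ne_zero hn'0)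
  have hcard := kerTorsCard_mul_card_map (fullWeight n d).toAddMonoidHom (p ^ b)
  rw [torsCard_fullDune h hd2 hδ hinj hpb ht', ← pow_mul] at hcard
  rw [← hcard, card_addSubgroup_zmod (t := p ^ (padicValNat p g - (a - b)))]
  · refine ((pow_dvd_pow p (Nat.sub_le _ _)).trans pow_padicValNat_dvd).trans ?_
    rw [hg]
    exact Nat.gcd_dvd_left _ _
  · rintro _ ⟨x, hx, rfl⟩
    obtain ⟨z, hz, rfl⟩ := (nsmul_eq_zero_iff_fullDune h hδ hinj hpb ht' x).1 hx
    change p ^ _ • weight n (t' • z) = 0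
    have h1 := weight_redMap h z
    rw [hz, map_zero] at h1
    obtain ⟨c, hc⟩ := ZMod.intCast_surjective (weight n z)
    rw [← hc, map_intCast, eq_comm, ZMod.intCast_zmod_eq_zero_iff_dvd] at h1
    obtain ⟨i, rfl⟩ := h1
    have h2 : weight n z = i • ((n' : ℤ) : ZMod n) := by
      rw [← hc]
      simp [mul_comm]
    rw [map_smul, h2, smul_comm t', smul_comm _ i, (hzero _).2 (by omega), smul_zero]
  · have hz : redMap h (Finsupp.single (n' : ZMod n) 1 - Finsupp.single 0 1) = 0 := by
      rw [map_sub, redMap_single, redMap_single]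
      simp
    have hw : weight n (t' • (Finsupp.single (n' : ZMod n) 1 - Finsupp.single 0 1)) =
        t' • ((n' : ℤ) : ZMod n) := by
      rw [map_smul, map_sub, weight_single, weight_single]
      simp
    refine ⟨t' • ((n' : ℤ) : ZMod n), ⟨_, (nsmul_eq_zero_iff_fullDune h hδ hinj hpb ht' _).2
      ⟨_, hz, rfl⟩, hw⟩, ?_⟩
    obtain ⟨j, hj, hj'⟩ := (Nat.dvd_prime_pow hp.out).1 (addOrderOf_dvd_of_nsmul_eq_zero
      ((hzero (padicValNat p g - (a - b))).2 (by omega)))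
    rw [hj']
    congr 1
    have h1 : p ^ j • t' • ((n' : ℤ) : ZMod n) = 0 := hj' ▸ addOrderOf_nsmul_eq_zero _
    rw [hzero] at h1
    omega

theorem kerTorsCard_full_pow_add {n n' g : ℕ} [NeZero n] (hn : n = n' * g) {d : ℤ}
    (hd2 : 2 ≤ |d|) (hg : g = Nat.gcd n d.natAbs) {p a e : ℕ} (hd : d.natAbs = p ^ a * e)
    (he : Nat.Coprime e p) (s : ℕ) :
    kerTorsCard (fullWeight n d).toAddMonoidHom (p ^ (a + s)) =
      kerTorsCard (fullWeight n d).toAddMonoidHom (p ^ a) *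
      kerTorsCard (fullWeight n' d).toAddMonoidHom (p ^ s) := by
  obtain ⟨δ, hinj, hδ⟩ := exists_dilation hn hg
  have hd0 : d ≠ 0 := by
    rintro rfl
    simp at hd2
  obtain ⟨π, ι, hι, hιπ, hw, hsurj⟩ := exists_fullDune_homs ⟨g, hn⟩ hδ hinj hd0
  rw [pow_add]
  refine kerTorsCard_mul_of_comp_eq_smul hι (e := e) (fun x => ?_) ?_ hw hsurj
  · rw [hιπ, ← hd, natAbs_smul_eq_zero_iff]
  · rw [← pow_add]
    exact he.pow_right _

/-- The multiplicity of the `i`-th free block in the group attached to the `d`-sequence of `n`. -/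
def blockRank (n : ℕ) (d : ℤ) (i : ℕ) : ℕ :=
  ((dSeq n d i : ℤ) - 2 * (dSeq n d (i + 1) : ℤ) + (dSeq n d (i + 2) : ℤ) - 1).toNat

theorem blockRank_dSeq_one (n : ℕ) (d : ℤ) (i : ℕ) :
    blockRank (dSeq n d 1) d i = blockRank n d (i + 1) := by
  simp only [blockRank, dSeq_dSeq_one]

theorem blockRank_add {n : ℕ} (hn : 0 < n) {d : ℤ} {i : ℕ}
    (h : Nat.gcd (dSeq n d i) d.natAbs ≠ 1) :
    blockRank n d i + 1 + 2 * dSeq n d (i + 1) = dSeq n d i + dSeq n d (i + 2) := by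
  have h1 := dSeq_succ_mul n d i
  have h2 := dSeq_pos hn d i
  have h3 := dSeq_pos hn d (i + 2)
  have h4 : 2 ≤ Nat.gcd (dSeq n d i) d.natAbs := by
    have := Nat.gcd_pos_of_pos_left d.natAbs h2
    omega
  have h5 := Nat.mul_le_mul_left (dSeq n d (i + 1)) h4
  rw [h1] at h5
  rw [blockRank]
  omega

theorem sum_blockRank {n : ℕ} (hn : 0 < n) {d : ℤ} {k : ℕ}
    (h : ∀ i < k, Nat.gcd (dSeq n d i) d.natAbs ≠ 1) :
    ∑ i ∈ range k, (blockRank n d i + 1) + dSeq n d 1 + dSeq n d k = n + dSeq n d (k + 1) := by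
  induction k with
  | zero => simp [dSeq, add_comm]
  | succ k ih =>
    have h1 := ih fun i hi => h i (by omega)
    have h2 : blockRank n d k + 1 + 2 * dSeq n d (k + 1) = dSeq n d k + dSeq n d (k + 1 + 1) :=
      blockRank_add hn (h k (by omega))
    rw [sum_range_succ]
    omega

/-- The exponent of `p` in the order of the `p ^ b`-torsion of the group attached to the first `k`
terms of the `d`-sequence of `n`. -/
def blockExponent (p a n : ℕ) (d : ℤ) (k b : ℕ) : ℕ :=
  ∑ i ∈ range k, (min b (a * (i + 1) - padicValNat p (Nat.gcd (dSeq n d i) d.natAbs)) +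
    min b (a * (i + 1)) * blockRank n d i)

theorem blockExponent_of_le {p a n : ℕ} (hn : 0 < n) {d : ℤ} {k b : ℕ}
    (ha : ∀ i, padicValNat p (Nat.gcd (dSeq n d i) d.natAbs) ≤ a) (hb : b ≤ a)
    (hk1 : Nat.gcd (dSeq n d k) d.natAbs = 1)
    (hk2 : ∀ i < k, Nat.gcd (dSeq n d i) d.natAbs ≠ 1) :
    blockExponent p a n d k b + (padicValNat p (Nat.gcd n d.natAbs) - (a - b)) =
      b * (n - dSeq n d 1) := by
  have h1 := sum_blockRank hn hk2
  have h2 : dSeq n d (k + 1) = dSeq n d k := by rw [dSeq, hk1, Nat.div_one]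
  have h3 : n - dSeq n d 1 = ∑ i ∈ range k, (blockRank n d i + 1) := by omega
  rw [h3, blockExponent]
  cases k with
  | zero =>
    have h4 : Nat.gcd n d.natAbs = 1 := hk1
    simp [h4]
  | succ k =>
    rw [mul_sum, sum_range_succ', sum_range_succ']
    have h4 : ∀ i ∈ range k, min b (a * (i + 1 + 1) - padicValNat p
        (Nat.gcd (dSeq n d (i + 1)) d.natAbs)) + min b (a * (i + 1 + 1)) * blockRank n d (i + 1) =
        b * (blockRank n d (i + 1) + 1) := by
      intro i _
      have h5 := ha (i + 1)
      have h6 : a * (i + 1 + 1) = a * i + a + a := by ring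
      rw [min_eq_left (by omega), min_eq_left (by omega)]
      ring
    rw [sum_congr rfl h4, zero_add, mul_one, min_eq_left hb, mul_add]
    have h5 := ha 0
    change padicValNat p (Nat.gcd n d.natAbs) ≤ a at h5
    change _ + (min b (a - padicValNat p (Nat.gcd n d.natAbs)) + _) + _ = _
    omega

theorem blockExponent_add {p a n : ℕ} {d : ℤ} {k : ℕ}
    (ha : ∀ i, padicValNat p (Nat.gcd (dSeq n d i) d.natAbs) ≤ a) (s : ℕ) :
    blockExponent p a n d (k + 1) (a + s) =
      blockExponent p a n d (k + 1) a + blockExponent p a (dSeq n d 1) d k s := by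
  rw [blockExponent, blockExponent, blockExponent, sum_range_succ', sum_range_succ',
    add_right_comm, ← sum_add_distrib]
  congr 1
  · refine sum_congr rfl fun i _ => ?_
    have h5 := ha (i + 1)
    have h6 : a * (i + 1 + 1) = a * (i + 1) + a := by ring
    have h7 : a * (i + 1) = a * i + a := by ring
    rw [blockRank_dSeq_one, dSeq_dSeq_one, min_eq_left (a := a) (by omega),
      min_eq_left (a := a) (by omega)]
    have h8 : min (a + s) (a * (i + 1 + 1)) = a + min s (a * (i + 1)) := by omega
    have h9 : min (a + s) (a * (i + 1 + 1) - padicValNat p (Nat.gcd (dSeq n d (i + 1)) d.natAbs)) =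
        a + min s (a * (i + 1) - padicValNat p (Nat.gcd (dSeq n d (i + 1)) d.natAbs)) := by omega
    rw [h8, h9]
    ring
  · have h5 := ha 0
    rw [zero_add, mul_one, min_eq_right (by omega), min_eq_right (by omega),
      min_eq_right (by omega), min_eq_right (by omega)]

theorem kerTorsCard_full {p a e : ℕ} [hp : Fact p.Prime] {d : ℤ} (hd2 : 2 ≤ |d|)
    (hd : d.natAbs = p ^ a * e) (he : Nat.Coprime e p) (ha : 0 < a) (b : ℕ) :
    ∀ (k n : ℕ), 0 < n → Nat.gcd (dSeq n d k) d.natAbs = 1 →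
      (∀ i < k, Nat.gcd (dSeq n d i) d.natAbs ≠ 1) →
      kerTorsCard (fullWeight n d).toAddMonoidHom (p ^ b) = p ^ blockExponent p a n d k b := by
  induction b using Nat.strong_induction_on with
  | _ b ih =>
    intro k n hn hk1 hk2
    have : NeZero n := ⟨hn.ne'⟩
    have hnn : n = dSeq n d 1 * Nat.gcd n d.natAbs := (dSeq_succ_mul n d 0).symm
    have hae : ∀ i, padicValNat p (Nat.gcd (dSeq n d i) d.natAbs) ≤ a := by
      intro i
      have h1 : p ^ padicValNat p (Nat.gcd (dSeq n d i) d.natAbs) ∣ p ^ a * e :=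
        hd ▸ pow_padicValNat_dvd.trans (Nat.gcd_dvd_right _ _)
      exact (Nat.pow_dvd_pow_iff_le_right hp.out.one_lt).1
        ((he.symm.pow_left _).dvd_of_dvd_mul_right h1)
    have hle : ∀ b ≤ a, kerTorsCard (fullWeight n d).toAddMonoidHom (p ^ b) =
        p ^ blockExponent p a n d k b := by
      intro b hb
      have h1 := kerTorsCard_full_mul hnn hd2 rfl hd he hb
      rw [← blockExponent_of_le hn hae hb hk1 hk2, pow_add] at h1
      exact Nat.eq_of_mul_eq_mul_right (pow_pos hp.out.pos _) h1
    rcases le_or_gt b a with hb | hb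
    · exact hle b hb
    · obtain ⟨s, rfl⟩ := Nat.exists_eq_add_of_le hb.le
      rw [kerTorsCard_full_pow_add hnn hd2 rfl hd he, hle a le_rfl]
      have hpos := dSeq_pos hn d 1
      cases k with
      | zero =>
        rw [ih s (by omega) 0 (dSeq n d 1) hpos
          (Nat.Coprime.coprime_dvd_left (dSeq_dvd n d 1) hk1) (by simp)]
        simp [blockExponent]
      | succ k =>
        rw [ih s (by omega) k (dSeq n d 1) hpos (by rwa [dSeq_dSeq_one]) (fun i hi => by
          rw [dSeq_dSeq_one]
          exact hk2 (i + 1) (by omega)), ← pow_add, blockExponent_add hae]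

theorem gcd_dvd_natAbs_pow_succ (m : ℕ) (d : ℤ) (i : ℕ) :
    Nat.gcd m d.natAbs ∣ d.natAbs ^ (i + 1) :=
  (Nat.gcd_dvd_right _ _).trans (dvd_pow_self _ i.succ_ne_zero)

theorem coprime_natAbs_pow_sub_one (d : ℤ) {o : ℕ} (ho : 0 < o) :
    Nat.Coprime d.natAbs (d ^ o - 1).natAbs := by
  rw [← Int.isCoprime_iff_nat_coprime]
  have h : IsCoprime (d ^ o) (d ^ o - 1) := ⟨1, -1, by ring⟩
  exact h.of_isCoprime_of_dvd_left (dvd_pow_self d ho.ne')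

/-- The torsion of the blocks coming from the part of `n` that shares factors with `d`. -/
theorem torsCard_blocks {d : ℤ} (hd0 : d ≠ 0) (n k t : ℕ) :
    torsCard ((i : Fin k) → (ZMod (d.natAbs ^ (i.1 + 1) / Nat.gcd (dSeq n d i.1) d.natAbs) ×
      (Fin (blockRank n d i.1) → ZMod (d.natAbs ^ (i.1 + 1))))) t =
      ∏ i ∈ range k, (Nat.gcd t (d.natAbs ^ (i + 1) / Nat.gcd (dSeq n d i) d.natAbs) *
        Nat.gcd t (d.natAbs ^ (i + 1)) ^ blockRank n d i) := by
  have h1 : ∀ i, d.natAbs ^ (i + 1) ≠ 0 := fun i => pow_ne_zero _ (Int.natAbs_ne_zero.2 hd0)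
  rw [torsCard_pi, Finset.prod_range]
  refine Finset.prod_congr rfl fun i _ => ?_
  rw [torsCard_prod, torsCard_pi, torsCard_zmod, torsCard_zmod (h1 i)]
  · simp
  · exact Nat.div_ne_zero_iff_of_dvd (gcd_dvd_natAbs_pow_succ _ _ _) |>.2
      ⟨h1 i, Nat.gcd_ne_zero_right (Int.natAbs_ne_zero.2 hd0)⟩

theorem torsCard_blocks_prime_pow {p a e : ℕ} [hp : Fact p.Prime] {d : ℤ} (hd0 : d ≠ 0)
    (hd : d.natAbs = p ^ a * e) (he : Nat.Coprime e p) (n k b : ℕ) :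
    ∏ i ∈ range k, (Nat.gcd (p ^ b) (d.natAbs ^ (i + 1) / Nat.gcd (dSeq n d i) d.natAbs) *
        Nat.gcd (p ^ b) (d.natAbs ^ (i + 1)) ^ blockRank n d i) =
      p ^ blockExponent p a n d k b := by
  have h1 : ∀ i, d.natAbs ^ (i + 1) ≠ 0 := fun i => pow_ne_zero _ (Int.natAbs_ne_zero.2 hd0)
  have he0 : e ≠ 0 := by
    rintro rfl
    simp [hd0] at hd
  have h2 : padicValNat p d.natAbs = a := by
    rw [hd, padicValNat.mul (pow_ne_zero _ hp.out.ne_zero) he0, padicValNat.prime_pow,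
      padicValNat.eq_zero_of_not_dvd, add_zero]
    exact fun h => hp.out.one_lt.ne' (Nat.eq_one_of_dvd_coprimes he h dvd_rfl)
  rw [blockExponent, ← Finset.prod_pow_eq_pow_sum]
  refine Finset.prod_congr rfl fun i _ => ?_
  rw [gcd_prime_pow_div_eq (h1 i) (gcd_dvd_natAbs_pow_succ _ _ _), gcd_prime_pow_eq (h1 i),
    padicValNat.pow, h2, pow_add, pow_mul, mul_comm (i + 1) a]

/-- main theorem: with `d`-sequence `n = n_0 > ⋯ > n_k = n_{k+1}`,
`d_i = gcd(n_i,|d|)`, `m = n_k`, a set `𝒱` of representatives of the nonzero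
orbits of `v ↦ d·v` on `ℤ/m` containing the classes of `m/p^j` for all primes
`p ∣ m` and `1 ≤ j ≤ ν_p(m)`, orbit sizes `o(v)`, and the correction factors
`c(v)` (equal to `π_p(m)` at `v = m/π_p(m)` in the non-exceptional case, to
`π_2(m)/2` at `v = m/π_2(m)` and to `2` at `v = m/2` in the exceptional case
`4 ∣ m`, `d ≡ 3 (mod 4)`, and to `1` otherwise):
`S(n,d) ≅ [⊕_{i<k} (ℤ/(|d|^{i+1}/d_i) ⊕ (ℤ/|d|^{i+1})^{n_i − 2n_{i+1} + n_{i+2} − 1})]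
⊕ [⊕_{v∈𝒱} ℤ/(|d^{o(v)} − 1|/c(v))]`; this is the sandpile (critical) group of
`DB(n,d)` for `d ≥ 2`, resp. of `Ktz(n,|d|)` for `d ≤ −2`. -/
theorem stmt16 (n : ℕ) (d : ℤ) (hn : 1 ≤ n) (hd : 2 ≤ |d|) (k : ℕ)
    (hk1 : Nat.gcd (dSeq n d k) d.natAbs = 1)
    (hk2 : ∀ i < k, Nat.gcd (dSeq n d i) d.natAbs ≠ 1)
    (V : Finset (ZMod (dSeq n d k))) (h0 : (0 : ZMod (dSeq n d k)) ∉ V)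
    (hcover : ∀ w : ZMod (dSeq n d k), w ≠ 0 →
      ∃ v ∈ V, ∃ i : ℕ, (d : ZMod (dSeq n d k)) ^ i * v = w)
    (hsep : ∀ v ∈ V, ∀ v' ∈ V,
      (∃ i : ℕ, (d : ZMod (dSeq n d k)) ^ i * v = v') → v = v')
    (hVstar : ∀ p : ℕ, p.Prime → p ∣ dSeq n d k →
      ∀ j : ℕ, 1 ≤ j → j ≤ padicValNat p (dSeq n d k) →
        ((dSeq n d k / p ^ j : ℕ) : ZMod (dSeq n d k)) ∈ V)
    (o : ZMod (dSeq n d k) → ℕ)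
    (ho : ∀ w : ZMod (dSeq n d k), 0 < o w ∧ (d : ZMod (dSeq n d k)) ^ (o w) * w = w ∧
      ∀ e : ℕ, 0 < e → (d : ZMod (dSeq n d k)) ^ e * w = w → o w ≤ e)
    (c : ZMod (dSeq n d k) → ℕ)
    (hc1 : ∀ p : ℕ, p.Prime → p ∣ dSeq n d k →
      (p ≠ 2 ∨ d % 4 = 1 ∨ ¬ (4 ∣ dSeq n d k)) →
      c ((dSeq n d k / p ^ padicValNat p (dSeq n d k) : ℕ) : ZMod (dSeq n d k)) =
        p ^ padicValNat p (dSeq n d k))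
    (hc2 : 4 ∣ dSeq n d k → d % 4 = 3 →
      c ((dSeq n d k / 2 ^ padicValNat 2 (dSeq n d k) : ℕ) : ZMod (dSeq n d k)) =
        2 ^ padicValNat 2 (dSeq n d k) / 2)
    (hc3 : 4 ∣ dSeq n d k → d % 4 = 3 →
      c ((dSeq n d k / 2 : ℕ) : ZMod (dSeq n d k)) = 2)
    (hc4 : ∀ v ∈ V,
      (∀ p : ℕ, p.Prime → p ∣ dSeq n d k →
        v ≠ ((dSeq n d k / p ^ padicValNat p (dSeq n d k) : ℕ) : ZMod (dSeq n d k))) →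
      ((4 ∣ dSeq n d k ∧ d % 4 = 3) → v ≠ ((dSeq n d k / 2 : ℕ) : ZMod (dSeq n d k))) →
      c v = 1) :
    Nonempty (Sandpile n d ≃+
      (((i : Fin k) →
        (ZMod (d.natAbs ^ (i.1 + 1) / Nat.gcd (dSeq n d i.1) d.natAbs) ×
          (Fin (((dSeq n d i.1 : ℤ) - 2 * (dSeq n d (i.1 + 1) : ℤ) +
              (dSeq n d (i.1 + 2) : ℤ) - 1).toNat) →
            ZMod (d.natAbs ^ (i.1 + 1))))) ×
        ((v : V) → ZMod ((d ^ o v.1 - 1).natAbs / c v.1)))) := by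
  classical
  have hd0 : d ≠ 0 := by
    rintro rfl
    simp at hd
  have hdn : d.natAbs ≠ 0 := Int.natAbs_ne_zero.2 hd0
  have : NeZero n := ⟨by omega⟩
  have hm0 : dSeq n d k ≠ 0 := (dSeq_pos hn d k).ne'
  have : NeZero (dSeq n d k) := ⟨hm0⟩
  have hmn := dSeq_dvd n d k
  have hK := dvd_pow_mul_dSeq n d k
  have : Finite (Dune n d) := finite_dune hmn hd hk1 hK h0 hcover hsep o ho
  have : Finite (Sandpile n d) := finite_sandpile
  have hd2 : 2 ∣ dSeq n d k → d % 2 = 1 := by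
    intro h2
    by_contra h
    have h3 : 2 ∣ d.natAbs := by omega
    have := Nat.dvd_gcd h2 h3
    omega
  have hD : ∀ v : V, (d ^ o v - 1).natAbs • (v : ZMod (dSeq n d k)) = 0 :=
    fun v => natAbs_smul_eq_zero (ho v).2.1
  have hD0 : ∀ v : V, (d ^ o v - 1).natAbs ≠ 0 := fun v =>
    pow_sub_one_natAbs_ne_zero hd (ho v).1
  have hcD : ∀ v : V, c v ∣ (d ^ o v - 1).natAbs := fun v =>
    (dvd_addOrderOf_and_prime_dvd hm0 hc1 hc2 hc3 hc4 hd2 v.2).1.trans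
      (addOrderOf_dvd_of_nsmul_eq_zero (hD v))
  have hDc0 : ∀ v : V, (d ^ o v - 1).natAbs / c v ≠ 0 := fun v =>
    Nat.div_ne_zero_iff_of_dvd (hcD v) |>.2
      ⟨hD0 v, fun h => hD0 v (by simpa [h] using hcD v)⟩
  have : ∀ i, NeZero (d.natAbs ^ (i + 1)) := fun i => ⟨pow_ne_zero _ hdn⟩
  have : ∀ i, NeZero (d.natAbs ^ (i + 1) / Nat.gcd (dSeq n d i) d.natAbs) := fun i =>
    ⟨Nat.div_ne_zero_iff_of_dvd (gcd_dvd_natAbs_pow_succ _ _ _) |>.2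
      ⟨pow_ne_zero _ hdn, Nat.gcd_ne_zero_right hdn⟩⟩
  have : ∀ v : V, NeZero ((d ^ o v - 1).natAbs / c v) := fun v => ⟨hDc0 v⟩
  refine nonempty_addEquiv_of_torsCard fun p hp b => ?_
  have : Fact p.Prime := ⟨hp⟩
  rw [torsCard_sandpile]
  refine Eq.trans ?_ ((torsCard_prod _).trans (congrArg₂ (· * ·) (torsCard_blocks hd0 n k (p ^ b))
    ((torsCard_pi _).trans
      (Finset.prod_congr rfl fun v _ => torsCard_zmod (hDc0 v) (p ^ b))))).symm
  by_cases hpd : p ∣ d.natAbs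
  · obtain ⟨a, e, he, hde⟩ := Nat.exists_eq_pow_mul_and_not_dvd hdn p hp.ne_one
    have hep : Nat.Coprime e p := ((Nat.Prime.coprime_iff_not_dvd hp).2 he).symm
    have hcop : ∀ o : ℕ, 0 < o → Nat.Coprime (p ^ b) (d ^ o - 1).natAbs := fun o ho =>
      ((coprime_natAbs_pow_sub_one d ho).coprime_dvd_left hpd).pow_left b
    have ha : 0 < a := by
      refine Nat.pos_of_ne_zero ?_
      rintro rfl
      rw [hde, pow_zero, one_mul] at hpd
      exact he hpd
    rw [Finset.prod_eq_one (s := univ) (fun (v : V) _ =>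
      (hcop _ (ho v).1).coprime_dvd_right (Nat.div_dvd_of_dvd (hcD v))), mul_one,
      kerTorsCard_dune_eq_full n d (by simpa using (hcop 1 one_pos).symm)]
    rw [torsCard_blocks_prime_pow hd0 hde hep n k b]
    exact kerTorsCard_full hd hde hep ha b k n hn hk1 hk2
  · have hcop : Nat.Coprime (p ^ b) d.natAbs :=
      ((Nat.Prime.coprime_iff_not_dvd hp).2 hpd).pow_left b
    rw [kerTorsCard_dune_eq_orbitWeight hmn hk1 hK h0 hcover hsep o ho hD hcop.symm,
      kerTorsCard_orbitWeight hd hk1 hVstar ho hc1 hc2 hc3 hc4 hD hp b,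
      Finset.prod_eq_one (s := range k), one_mul]
    intro i _
    have h1 := hcop.pow_right (i + 1)
    rw [Nat.Coprime.gcd_eq_one h1, one_pow, mul_one]
    exact h1.coprime_dvd_right (Nat.div_dvd_of_dvd (gcd_dvd_natAbs_pow_succ _ _ _))
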